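/- arXiv:1801.05973 — 2 statements merged into one kernel-verified Lean document; each statement's English description precedes it below -/
import Mathlib

section
/- Let n ≥ 9, let λ be a multiset of integers each at least 2, and let r ≥ 1 be an integer with r + Σ_{c∈λ} c = n − 1, such that the multiset λ ∪ {r} contains a positive even number of even entries. Then there exists an irreducible permutation σ of {1,…,n} with cycle invariant (λ, r); moreover every irreducible permutation with this cycle invariant has Ā(σ) = 0. -/
open scoped Classical

namespace Rauzy

/-- A permutation `σ` of `{1,…,n}` (0-based: `Fin n`) is irreducible if it maps no initial
segment `{1,…,k}` (with `k < n`) onto the final segment `{n-k+1,…,n}`. -/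
def rauzyIrreducible {n : ℕ} (σ : Equiv.Perm (Fin n)) : Prop :=
  ∀ k : ℕ, 1 ≤ k → k < n →
    Finset.image (fun j => σ j) (Finset.univ.filter fun j : Fin n => j.val < k) ≠
      Finset.univ.filter fun j : Fin n => n - k ≤ j.val

/-- The permutation of the set of "top arcs plus rank-path marker" obtained by following
the paths of the cycle-invariant construction: `0` stands for the (closed-up) rank path
marker and `j ≥ 1` for the top arc between top endpoints `j` and `j+1` (1-based). -/
def cycleMap : {n : ℕ} → Equiv.Perm (Fin n) → Equiv.Perm (Fin n)
  | 0, _ => 1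
  | (n + 1), σ =>
      finRotate (n + 1) * Equiv.swap (σ 0) (Fin.last n) * σ * finRotate (n + 1) * σ⁻¹

/-- The rank `r(σ)`: the number of top arcs on the open (rank) path. -/
noncomputable def rauzyRank : {n : ℕ} → Equiv.Perm (Fin n) → ℕ
  | 0, _ => 0
  | (_ + 1), σ => Set.ncard {x | (cycleMap σ).SameCycle 0 x} - 1

/-- The cycle structure `λ(σ)`: the multiset of the lengths (numbers of top arcs) of the
closed cycles of the cycle-invariant construction. -/
noncomputable def rauzyLambda : {n : ℕ} → Equiv.Perm (Fin n) → Multiset ℕ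
  | 0, _ => 0
  | (_ + 1), σ =>
      (Finset.univ.filter fun j =>
          (∀ x, (cycleMap σ).SameCycle j x → j ≤ x) ∧ ¬ (cycleMap σ).SameCycle 0 j).val.map
        fun j => Set.ncard {x | (cycleMap σ).SameCycle j x}

/-- `χ_I(σ)`: the number of pairs of non-crossing edges of `σ` with both endpoints in `I`. -/
def chiSet {n : ℕ} (σ : Equiv.Perm (Fin n)) (I : Finset (Fin n)) : ℕ :=
  ((I ×ˢ I).filter fun pr => pr.1 < pr.2 ∧ σ pr.1 < σ pr.2).card

/-- `A(σ) = Σ_{I ⊆ [n]} (-1)^{χ_I(σ)}`. -/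
def arfA {n : ℕ} (σ : Equiv.Perm (Fin n)) : ℤ :=
  ∑ I : Finset (Fin n), (-1 : ℤ) ^ (chiSet σ I)

/-- The Arf invariant `Ā(σ) = Σ_{I ⊆ [n]} (-1)^{|I| + χ_I(σ)}`. -/
def arfBar {n : ℕ} (σ : Equiv.Perm (Fin n)) : ℤ :=
  ∑ I : Finset (Fin n), (-1 : ℤ) ^ (I.card + chiSet σ I)

/-- The sign `s(σ) ∈ {-1, 0, +1}` of the Arf invariant. -/
def arfSign {n : ℕ} (σ : Equiv.Perm (Fin n)) : ℤ := Int.sign (arfBar σ)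

/-- The indicator, in `ZMod 2`, of a pair of non-crossing edges taken in increasing order. -/
def nonCrossing {n : ℕ} (σ : Equiv.Perm (Fin n)) (i j : Fin n) : ZMod 2 :=
  if i < j ∧ σ i < σ j then 1 else 0

/-- The quadratic form over `ZMod 2` whose Gauss sum is `arfBar σ`. -/
def quadForm {n : ℕ} (σ : Equiv.Perm (Fin n)) (x : Fin n → ZMod 2) : ZMod 2 :=
  ∑ i, x i + ∑ i, ∑ j, nonCrossing σ i j * (x i * x j)

/-- The indicator function of a finset, with values in `ZMod 2`. -/
def indic {n : ℕ} (I : Finset (Fin n)) (i : Fin n) : ZMod 2 := if i ∈ I then 1 else 0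

/-- The pairing of the edge `i` with `y` under the polarization of `quadForm σ`. -/
def edgePairing {n : ℕ} (σ : Equiv.Perm (Fin n)) (y : Fin n → ZMod 2) (i : Fin n) : ZMod 2 :=
  ∑ j, (nonCrossing σ i j + nonCrossing σ j i) * y j

lemma cast_card_add_chiSet {n : ℕ} (σ : Equiv.Perm (Fin n)) (I : Finset (Fin n)) :
    ((I.card + chiSet σ I : ℕ) : ZMod 2) = quadForm σ (indic I) := by
  unfold quadForm chiSet indic nonCrossing
  rw [Nat.cast_add]
  congr 1
  · simp
  · rw [← Finset.sum_product', Finset.card_filter, Nat.cast_sum]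
    have hsub : I ×ˢ I ⊆ (Finset.univ : Finset (Fin n)) ×ˢ Finset.univ := by
      simp
    rw [← Finset.sum_subset hsub]
    · refine Finset.sum_congr rfl fun p hp => ?_
      rw [Finset.mem_product] at hp
      simp [hp.1, hp.2]
    · intro p _ hp
      rw [Finset.mem_product, not_and_or] at hp
      rcases hp with h | h <;> simp [h]

lemma quadForm_add {n : ℕ} (σ : Equiv.Perm (Fin n)) (x y : Fin n → ZMod 2) :
    quadForm σ (x + y) = quadForm σ x + quadForm σ y + ∑ i, x i * edgePairing σ y i := by
  have h : ∑ i, x i * edgePairing σ y i =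
      ∑ i, ∑ j, nonCrossing σ i j * (x i * y j) + ∑ i, ∑ j, nonCrossing σ i j * (x j * y i) := by
    rw [Finset.sum_comm (f := fun i j => nonCrossing σ i j * (x j * y i)),
      ← Finset.sum_add_distrib]
    refine Finset.sum_congr rfl fun i _ => ?_
    rw [edgePairing, Finset.mul_sum, ← Finset.sum_add_distrib]
    exact Finset.sum_congr rfl fun j _ => by ring
  rw [h]
  simp only [quadForm, Pi.add_apply, add_mul, mul_add, Finset.sum_add_distrib]
  have h' : ∑ i, ∑ j, nonCrossing σ i j * (y i * x j) =
      ∑ i, ∑ j, nonCrossing σ i j * (x j * y i) := by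
    simp only [mul_comm (y _)]
  rw [h']
  ring

lemma indic_symmDiff {n : ℕ} (I V : Finset (Fin n)) :
    indic (symmDiff I V) = indic I + indic V := by
  funext i
  simp only [indic, Pi.add_apply, Finset.mem_symmDiff]
  by_cases h1 : i ∈ I <;> by_cases h2 : i ∈ V <;> simp [h1, h2]
  decide

lemma neg_one_pow_of_cast_eq_add_one {a b : ℕ} (h : (a : ZMod 2) = b + 1) :
    (-1 : ℤ) ^ a = -(-1) ^ b := by
  have h' : ((a : ℕ) : ZMod 2) = ((b + 1 : ℕ) : ZMod 2) := by push_cast; exact h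
  rw [ZMod.natCast_eq_natCast_iff] at h'
  rw [neg_one_pow_congr (n := b + 1), pow_succ]
  · ring
  · simp only [Nat.even_iff]
    rw [Nat.ModEq] at h'
    rw [h']

/-- The Gauss sum vanishes if the form takes the value `1` on a vector of its radical. -/
lemma arfBar_eq_zero_of_radical {n : ℕ} (σ : Equiv.Perm (Fin n)) (v : Fin n → ZMod 2)
    (hrad : ∀ i, edgePairing σ v i = 0) (hv : quadForm σ v = 1) : arfBar σ = 0 := by
  obtain ⟨V, rfl⟩ : ∃ V : Finset (Fin n), indic V = v := by
    refine ⟨Finset.univ.filter fun i => v i = 1, funext fun i => ?_⟩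
    have : ∀ a : ZMod 2, (if a = 1 then 1 else 0) = a := by decide
    simp [indic, this]
  have hinv : Function.Involutive fun I : Finset (Fin n) => symmDiff I V :=
    fun I => symmDiff_symmDiff_cancel_right V I
  have h : arfBar σ = -arfBar σ := by
    conv_lhs => rw [arfBar, ← Equiv.sum_comp hinv.toPerm]
    rw [arfBar, ← Finset.sum_neg_distrib]
    refine Finset.sum_congr rfl fun I _ => neg_one_pow_of_cast_eq_add_one ?_
    rw [cast_card_add_chiSet, cast_card_add_chiSet]
    simp [indic_symmDiff, quadForm_add, hrad, hv]
  omega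

/-- The number of inversions of `f` on `S`, modulo `2`. -/
def invParity {n : ℕ} (f : Fin n → Fin n) (S : Finset (Fin n)) : ZMod 2 :=
  ∑ a ∈ S, ∑ b ∈ S, if a < b ∧ f b < f a then 1 else 0

lemma sum_sum_eq_zero_of_swap {n : ℕ} (S : Finset (Fin n)) (h : Fin n → Fin n → ZMod 2)
    (hs : ∀ a ∈ S, ∀ b ∈ S, h a b = h b a) (hd : ∀ a, h a a = 0) :
    ∑ a ∈ S, ∑ b ∈ S, h a b = 0 := by
  rw [← Finset.sum_product']
  refine Finset.sum_involution (fun p _ => p.swap) ?_ ?_ ?_ ?_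
  · rintro ⟨a, b⟩ hp
    rw [Finset.mem_product] at hp
    simp only [Prod.swap_prod_mk]
    rw [hs b hp.2 a hp.1]
    exact CharTwo.add_self_eq_zero _
  · rintro ⟨a, b⟩ _ hne heq
    simp only [Prod.swap_prod_mk, Prod.mk.injEq] at heq
    rw [heq.1] at hne
    exact hne (hd _)
  · rintro ⟨a, b⟩ hp
    rw [Finset.mem_product] at hp ⊢
    exact ⟨hp.2, hp.1⟩
  · rintro ⟨a, b⟩ _
    rfl

lemma invParity_trans {n : ℕ} (f g : Equiv.Perm (Fin n)) (S : Finset (Fin n)) :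
    invParity (f.trans g) S = invParity f S + invParity g (S.image f) := by
  have key : invParity (f.trans g) S + (invParity f S + invParity g (S.image f)) = 0 := by
    unfold invParity
    simp_rw [Finset.sum_image f.injective.injOn]
    simp only [← Finset.sum_add_distrib]
    refine sum_sum_eq_zero_of_swap S _ (fun a _ b _ => ?_) (fun _ => by simp)
    rcases eq_or_ne a b with rfl | hab
    · rfl
    have h1 : f a ≠ f b := f.injective.ne hab
    have h2 : g (f a) ≠ g (f b) := g.injective.ne h1
    rcases lt_or_gt_of_ne hab with q1 | q1 <;> rcases lt_or_gt_of_ne h1 with q2 | q2 <;>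
      rcases lt_or_gt_of_ne h2 with q3 | q3 <;>
      simp [q1, q2, q3, q1.not_gt, q2.not_gt, q3.not_gt, CharTwo.add_self_eq_zero]
  rwa [CharTwo.add_eq_zero] at key

lemma invParity_eq_zero_of_strictMonoOn {n : ℕ} (f : Fin n → Fin n) (S : Finset (Fin n))
    (hf : StrictMonoOn f S) : invParity f S = 0 :=
  Finset.sum_eq_zero fun _ ha => Finset.sum_eq_zero fun _ hb =>
    if_neg fun h => h.2.not_gt (hf ha hb h.1)

lemma invParity_univ_eq_one {k : ℕ} (π : Equiv.Perm (Fin k)) (h : π.sign = -1) :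
    invParity π Finset.univ = 1 := by
  have hprod : ∀ i, ∏ j ∈ Finset.Ioi i, (if π i < π j then (1 : ℤˣ) else -1) =
      (-1) ^ (Finset.univ.filter fun j => i < j ∧ π j < π i).card := by
    intro i
    rw [Finset.prod_ite, Finset.prod_const_one, one_mul, Finset.prod_const]
    congr 2
    ext j
    simp only [Finset.mem_filter, Finset.mem_Ioi, Finset.mem_univ, true_and, not_lt]
    refine and_congr_right fun hij => ⟨fun hle => lt_of_le_of_ne hle fun e => ?_, le_of_lt⟩
    exact hij.ne (π.injective e).symm
  rw [Equiv.Perm.sign_eq_prod_prod_Ioi] at h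
  simp_rw [hprod] at h
  rw [Finset.prod_pow_eq_pow_sum] at h
  have hodd := (neg_one_pow_eq_neg_one_iff_odd (by decide)).1 h
  rw [← ZMod.natCast_eq_one_iff_odd] at hodd
  rw [← hodd, Nat.cast_sum]
  refine Finset.sum_congr rfl fun i _ => ?_
  rw [Finset.card_filter, Nat.cast_sum]
  exact Finset.sum_congr rfl fun j _ => by simp

lemma invParity_eq_one_of_even_orbit {n : ℕ} (Φ : Equiv.Perm (Fin n)) (j : Fin n)
    (C : Finset (Fin n)) (hC : ∀ x, x ∈ C ↔ Φ.SameCycle j x) (heven : Even C.card) :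
    invParity Φ C = 1 := by
  have hmem : ∀ x, Φ x ∈ C ↔ x ∈ C := fun x => by
    rw [hC, hC, Equiv.Perm.sameCycle_apply_right]
  have hj : Φ j ≠ j := fun hfix => by
    have : C = {j} := by
      ext x
      rw [hC, Finset.mem_singleton]
      refine ⟨fun h => ?_, fun h => h ▸ Equiv.Perm.SameCycle.refl _ _⟩
      obtain ⟨i, hi⟩ := h
      rw [← hi, Equiv.Perm.zpow_apply_eq_self_of_apply_eq_self hfix]
    simp [this] at heven
  set ρ : Equiv.Perm {x // x ∈ C} := Φ.subtypePerm hmem with hρ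
  set e := C.orderIsoOfFin rfl with he
  set π : Equiv.Perm (Fin C.card) := (e.toEquiv.trans ρ).trans e.toEquiv.symm with hπ
  have hsign : π.sign = -1 := by
    have hcyc : Equiv.Perm.ofSubtype ρ = Φ.cycleOf j := by
      ext x
      rw [Equiv.Perm.cycleOf_apply]
      by_cases hx : x ∈ C
      · rw [Equiv.Perm.ofSubtype_apply_of_mem _ hx, if_pos ((hC x).1 hx)]
        rfl
      · rw [Equiv.Perm.ofSubtype_apply_of_not_mem _ hx, if_neg (fun h => hx ((hC x).2 h))]
    have hsupp : (Φ.cycleOf j).support = C := by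
      ext x
      rw [Equiv.Perm.mem_support_cycleOf_iff' hj, hC]
    rw [hπ, Equiv.Perm.sign_trans_trans_symm, ← Equiv.Perm.sign_ofSubtype, hcyc,
      (Equiv.Perm.isCycle_cycleOf Φ hj).sign, hsupp, heven.neg_one_pow]
  rw [← invParity_univ_eq_one π hsign, invParity, invParity, ← Finset.sum_coe_sort,
    ← Equiv.sum_comp e.toEquiv]
  refine Finset.sum_congr rfl fun a _ => ?_
  rw [← Finset.sum_coe_sort, ← Equiv.sum_comp e.toEquiv]
  refine Finset.sum_congr rfl fun b _ => ?_
  have h1 : ∀ c, Φ (e c) = e (π c) := fun c => by simp [hπ, hρ]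
  simp [h1]

lemma sum_indic_mul {n : ℕ} (S : Finset (Fin n)) (f : Fin n → ZMod 2) :
    ∑ i, indic S i * f i = ∑ i ∈ S, f i := by
  simp [indic]

lemma quadForm_indic {n : ℕ} (σ : Equiv.Perm (Fin n)) (S : Finset (Fin n)) :
    quadForm σ (indic S) = S.card + invParity σ S +
      ∑ a ∈ S, ∑ b ∈ S, (if a < b then 1 else 0) := by
  have h1 : ∑ i, indic S i = S.card := by simp [indic]
  have h2 : ∑ i, ∑ j, nonCrossing σ i j * (indic S i * indic S j) =
      ∑ a ∈ S, ∑ b ∈ S, nonCrossing σ a b := by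
    rw [← sum_indic_mul S]
    refine Finset.sum_congr rfl fun i _ => ?_
    rw [← sum_indic_mul S, Finset.mul_sum]
    exact Finset.sum_congr rfl fun j _ => by ring
  have h3 : ∑ a ∈ S, ∑ b ∈ S, nonCrossing σ a b =
      invParity σ S + ∑ a ∈ S, ∑ b ∈ S, (if a < b then 1 else 0) := by
    rw [invParity, ← Finset.sum_add_distrib]
    refine Finset.sum_congr rfl fun a _ => ?_
    rw [← Finset.sum_add_distrib]
    refine Finset.sum_congr rfl fun b _ => ?_
    rcases lt_trichotomy a b with h | rfl | h
    · rcases lt_or_gt_of_ne (fun e => h.ne (σ.injective e)) with h' | h' <;>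
        simp [nonCrossing, h, h', h'.not_gt, CharTwo.add_self_eq_zero]
    · simp [nonCrossing]
    · simp [nonCrossing, h.not_gt]
  rw [quadForm, h1, h2, h3, add_assoc]

lemma finRotate_strictMonoOn {m : ℕ} (S : Finset (Fin (m + 1))) (h : Fin.last m ∉ S) :
    StrictMonoOn (finRotate (m + 1)) S := by
  intro a ha b hb hab
  rw [Fin.lt_def, coe_finRotate_of_ne_last (fun e => h (e ▸ ha)),
    coe_finRotate_of_ne_last (fun e => h (e ▸ hb))]
  exact Nat.add_lt_add_right hab 1

lemma nonCrossing_add_comm {n : ℕ} (σ : Equiv.Perm (Fin n)) (i j : Fin n) :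
    nonCrossing σ i j + nonCrossing σ j i =
      1 + (if j ≤ i then 1 else 0) + (if σ j < σ i then 1 else 0) := by
  rcases lt_trichotomy i j with h | rfl | h
  · rcases lt_or_gt_of_ne (fun e => h.ne (σ.injective e)) with h' | h' <;>
      simp [nonCrossing, h, h', h'.not_gt, h.not_ge, h.not_gt, CharTwo.add_self_eq_zero]
  · simp [nonCrossing, CharTwo.add_self_eq_zero]
  · rcases lt_or_gt_of_ne (fun e => h.ne (σ.injective e)) with h' | h' <;>
      simp [nonCrossing, h, h', h'.not_gt, h.le, h.not_gt, CharTwo.add_self_eq_zero]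

lemma cycleMap_apply {m : ℕ} (σ : Equiv.Perm (Fin (m + 1))) (j : Fin (m + 1)) :
    cycleMap σ (σ j) =
      finRotate (m + 1) (Equiv.swap (σ 0) (Fin.last m) (σ (finRotate (m + 1) j))) := by
  simp [cycleMap]

/-- Edges traversed upwards by the cycles whose top arcs form the set `C`. -/
def upEdges {m : ℕ} (σ : Equiv.Perm (Fin (m + 1))) (C : Finset (Fin (m + 1))) :
    Fin (m + 1) → ZMod 2 :=
  Fin.cases (indic C (finRotate (m + 1) (σ 0))) fun i => indic C (σ i.castSucc)

/-- The edges traversed an odd number of times by the cycles whose top arcs form the set `C`. -/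
def cycleVector {m : ℕ} (σ : Equiv.Perm (Fin (m + 1))) (C : Finset (Fin (m + 1)))
    (j : Fin (m + 1)) : ZMod 2 :=
  indic C (σ j) + upEdges σ C j

section

variable {m : ℕ} (σ : Equiv.Perm (Fin (m + 1))) (C : Finset (Fin (m + 1)))

lemma upEdges_eq (hC : ∀ x, cycleMap σ x ∈ C ↔ x ∈ C) (j : Fin (m + 1)) :
    upEdges σ C j = if σ j = Fin.last m then indic C (finRotate (m + 1) (σ 0))
      else indic C (finRotate (m + 1) (σ j)) := by
  refine Fin.cases ?_ (fun i => ?_) j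
  · simp [upEdges]
  · have h : indic C (σ i.castSucc) = indic C (cycleMap σ (σ i.castSucc)) := by
      simp [indic, hC]
    rw [upEdges, Fin.cases_succ, h, cycleMap_apply, finRotate_apply i.castSucc,
      Fin.coeSucc_eq_succ]
    split_ifs with hl
    · rw [hl, Equiv.swap_apply_right]
    · rw [Equiv.swap_apply_of_ne_of_ne (fun e => ?_) hl]
      exact Fin.succ_ne_zero i (σ.injective e)

lemma apply_last_notMem (hC : ∀ x, cycleMap σ x ∈ C ↔ x ∈ C) (h0 : 0 ∉ C) :
    σ (Fin.last m) ∉ C := by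
  rw [← hC, cycleMap_apply, finRotate_last, Equiv.swap_apply_left, finRotate_last]
  exact h0

lemma sum_cycleVector_le (i : Fin (m + 1)) :
    ∑ j, (if j ≤ i then cycleVector σ C j else 0) =
      indic C (finRotate (m + 1) (σ 0)) + indic C (σ i) := by
  induction i using Fin.induction with
  | zero =>
    simp only [Fin.le_zero_iff, Finset.sum_ite_eq', Finset.mem_univ, if_true]
    simp [cycleVector, upEdges, add_comm]
  | succ i ih =>
    have h : ∀ j, (if j ≤ i.succ then cycleVector σ C j else 0) =
        (if j ≤ i.castSucc then cycleVector σ C j else 0) +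
          (if j = i.succ then cycleVector σ C j else 0) := by
      intro j
      rcases lt_trichotomy j i.succ with h | rfl | h
      · simp [h.le, h.ne, Fin.le_castSucc_iff.2 h]
      · simp
      · simp [h.not_ge, h.ne', Fin.le_castSucc_iff, h.not_gt]
    rw [Finset.sum_congr rfl fun j _ => h j, Finset.sum_add_distrib, ih, Finset.sum_ite_eq',
      if_pos (Finset.mem_univ _), cycleVector, upEdges, Fin.cases_succ]
    linear_combination CharTwo.add_self_eq_zero (indic C (σ i.castSucc))

lemma sum_cycleVector_lt (hC : ∀ x, cycleMap σ x ∈ C ↔ x ∈ C) (h0 : 0 ∉ C) (t : Fin (m + 1)) :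
    ∑ s, (if s < t then cycleVector σ C (σ.symm s) else 0) = indic C t := by
  induction t using Fin.induction with
  | zero => simp [indic, h0]
  | succ t ih =>
    have h : ∀ j, (if j < t.succ then cycleVector σ C (σ.symm j) else 0) =
        (if j < t.castSucc then cycleVector σ C (σ.symm j) else 0) +
          (if j = t.castSucc then cycleVector σ C (σ.symm j) else 0) := by
      intro j
      rcases lt_trichotomy j t.castSucc with h | rfl | h
      · simp [h, h.ne, ← Fin.le_castSucc_iff, h.le]
      · simp
      · simp [h.not_gt, h.ne', ← Fin.le_castSucc_iff, h.not_ge]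
    rw [Finset.sum_congr rfl fun j _ => h j, Finset.sum_add_distrib, ih, Finset.sum_ite_eq',
      if_pos (Finset.mem_univ _), cycleVector, upEdges_eq σ C hC, Equiv.apply_symm_apply,
      if_neg (Fin.castSucc_lt_last t).ne, finRotate_apply, Fin.coeSucc_eq_succ]
    linear_combination CharTwo.add_self_eq_zero (indic C t.castSucc)

lemma edgePairing_cycleVector (hC : ∀ x, cycleMap σ x ∈ C ↔ x ∈ C) (h0 : 0 ∉ C)
    (i : Fin (m + 1)) : edgePairing σ (cycleVector σ C) i = 0 := by
  have hall : ∑ j, cycleVector σ C j = indic C (finRotate (m + 1) (σ 0)) := by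
    have h := sum_cycleVector_le σ C (Fin.last m)
    simpa [Fin.le_last, indic, apply_last_notMem σ C hC h0] using h
  have hlt := sum_cycleVector_lt σ C hC h0 (σ i)
  rw [← Equiv.sum_comp σ] at hlt
  simp only [Equiv.symm_apply_apply] at hlt
  have hle := sum_cycleVector_le σ C i
  simp only [edgePairing, nonCrossing_add_comm, add_mul, one_mul, ite_mul, zero_mul,
    Finset.sum_add_distrib]
  rw [hall, hle, hlt]
  linear_combination CharTwo.add_self_eq_zero (indic C (finRotate (m + 1) (σ 0))) +
    CharTwo.add_self_eq_zero (indic C (σ i))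

end

lemma invParity_swap_last {m : ℕ} (p : Fin (m + 1)) (G : Finset (Fin (m + 1))) (hp : p ∉ G) :
    invParity (Equiv.swap p (Fin.last m)) G =
      if Fin.last m ∈ G then (∑ a ∈ G, if p < a then 1 else 0) + 1 else 0 := by
  have hfix : ∀ a ∈ G, a ≠ Fin.last m → Equiv.swap p (Fin.last m) a = a := fun a ha hl =>
    Equiv.swap_apply_of_ne_of_ne (fun e => hp (e ▸ ha)) hl
  split_ifs with hG
  · have hpl : p < Fin.last m := lt_of_le_of_ne (Fin.le_last p) fun e => hp (e ▸ hG)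
    have hinner : ∀ a ∈ G, (∑ b ∈ G, if a < b ∧ Equiv.swap p (Fin.last m) b <
        Equiv.swap p (Fin.last m) a then (1 : ZMod 2) else 0) =
        (if p < a then 1 else 0) + if a = Fin.last m then 1 else 0 := by
      intro a ha
      rw [Finset.sum_eq_single_of_mem _ hG]
      · rw [Equiv.swap_apply_right]
        by_cases hl : a = Fin.last m
        · simp [hl, hpl, CharTwo.add_self_eq_zero]
        · simp [hl, hfix a ha hl, lt_of_le_of_ne (Fin.le_last a) hl]
      · intro b hb hbl
        refine if_neg fun h => ?_
        have hal : a ≠ Fin.last m := fun e => (Fin.le_last b).not_gt (e ▸ h.1)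
        rw [hfix a ha hal, hfix b hb hbl] at h
        exact h.1.not_gt h.2
    rw [invParity, Finset.sum_congr rfl hinner, Finset.sum_add_distrib, Finset.sum_ite_eq',
      if_pos hG]
  · refine invParity_eq_zero_of_strictMonoOn _ _ fun a ha b hb hab => ?_
    rwa [hfix a ha (fun e => hG (e ▸ ha)), hfix b hb (fun e => hG (e ▸ hb))]

lemma edgePairing_indic_zero {m : ℕ} (σ : Equiv.Perm (Fin (m + 1)))
    (E : Finset (Fin (m + 1))) (hE : 0 ∉ E) :
    edgePairing σ (indic E) 0 = ∑ e ∈ E, if σ 0 < σ e then 1 else 0 := by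
  have h : edgePairing σ (indic E) 0 =
      ∑ j, indic E j * (nonCrossing σ 0 j + nonCrossing σ j 0) :=
    Finset.sum_congr rfl fun j _ => mul_comm _ _
  rw [h, sum_indic_mul]
  refine Finset.sum_congr rfl fun e he => ?_
  have he0 : 0 < e := Fin.pos_of_ne_zero fun h => hE (h ▸ he)
  simp [nonCrossing, he0]

section

variable {m : ℕ} (σ : Equiv.Perm (Fin (m + 1))) (C : Finset (Fin (m + 1)))

lemma quadForm_cycleVector (hC : ∀ x, cycleMap σ x ∈ C ↔ x ∈ C) (h0 : 0 ∉ C) :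
    quadForm σ (cycleVector σ C) = invParity (cycleMap σ) C := by
  set R := finRotate (m + 1) with hR
  set B := C.image σ.symm with hB
  set E := B.image R with hE
  set G := E.image σ with hG
  have hmemB : ∀ b, b ∈ B ↔ σ b ∈ C := fun b => by
    rw [hB, ← Equiv.coe_toEmbedding, ← Finset.map_eq_image, Finset.mem_map_equiv, Equiv.symm_symm]
  have hmemE : ∀ e, R e ∈ E ↔ e ∈ B := fun e => R.injective.mem_finset_image
  have hmemG : ∀ e, σ e ∈ G ↔ e ∈ E := fun e => σ.injective.mem_finset_image
  have hlast : Fin.last m ∉ B := by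
    rw [hmemB]
    exact apply_last_notMem σ C hC h0
  have hE0 : 0 ∉ E := by
    rw [← finRotate_last, hmemE]
    exact hlast
  have hp : σ 0 ∉ G := by rwa [hmemG]
  have hM : Fin.last m ∈ G ↔ R (σ 0) ∈ C := by
    obtain ⟨e, he⟩ := σ.surjective (Fin.last m)
    obtain ⟨b, rfl⟩ := R.surjective e
    rw [← he, hmemG, hmemE, hmemB, ← hC, cycleMap_apply, he, Equiv.swap_apply_right]
  have hd : (fun j => indic C (σ j)) = indic B := funext fun j => by simp [indic, hmemB]
  have hu : upEdges σ C = indic E + if Fin.last m ∈ G then indic {0} else 0 := by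
    funext j
    induction j using Fin.cases with
    | zero => by_cases hl : R (σ 0) ∈ C <;> simp [upEdges, indic, hE0, hM, ← hR, hl]
    | succ i =>
      have : i.succ ∈ E ↔ σ i.castSucc ∈ C := by
        rw [← Fin.coeSucc_eq_succ, ← finRotate_apply, hmemE, hmemB]
      by_cases hl : R (σ 0) ∈ C <;> simp [upEdges, indic, this, hM, hl]
  have hv : cycleVector σ C = indic B + upEdges σ C := by
    rw [← hd]
    rfl
  have hpair : ∑ i, indic B i * edgePairing σ (upEdges σ C) i = 0 := by
    have h : ∀ i, edgePairing σ (upEdges σ C) i = edgePairing σ (indic B) i := by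
      intro i
      have h1 : edgePairing σ (cycleVector σ C) i =
          edgePairing σ (indic B) i + edgePairing σ (upEdges σ C) i := by
        simp only [hv, edgePairing, Pi.add_apply, mul_add, Finset.sum_add_distrib]
      rw [edgePairing_cycleVector σ C hC h0] at h1
      exact (CharTwo.add_eq_zero.1 h1.symm).symm
    simp only [h]
    rw [sum_indic_mul]
    have h2 : ∀ i, edgePairing σ (indic B) i =
        ∑ j ∈ B, (nonCrossing σ i j + nonCrossing σ j i) := fun i => by
      rw [← sum_indic_mul B]
      exact Finset.sum_congr rfl fun j _ => mul_comm _ _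
    simp only [h2]
    exact sum_sum_eq_zero_of_swap B _ (fun a _ b _ => add_comm _ _)
      fun a => CharTwo.add_self_eq_zero _
  have hcardE : (E.card : ZMod 2) = B.card := by
    rw [hE, Finset.card_image_of_injective _ R.injective]
  have hpairs : ∑ a ∈ E, ∑ b ∈ E, (if a < b then (1 : ZMod 2) else 0) =
      ∑ a ∈ B, ∑ b ∈ B, (if a < b then 1 else 0) := by
    rw [hE, Finset.sum_image R.injective.injOn]
    refine Finset.sum_congr rfl fun a ha => ?_
    rw [Finset.sum_image R.injective.injOn]
    refine Finset.sum_congr rfl fun b hb => ?_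
    have h : R a < R b ↔ a < b := (finRotate_strictMonoOn B hlast).lt_iff_lt ha hb
    simp only [h]
  have hquadU : quadForm σ (upEdges σ C) = quadForm σ (indic E) +
      invParity (Equiv.swap (σ 0) (Fin.last m)) G := by
    rw [invParity_swap_last _ _ hp]
    split_ifs with hl
    · have h0' : ∑ i, indic {0} i * edgePairing σ (indic E) i =
          ∑ a ∈ G, if σ 0 < a then 1 else 0 := by
        rw [sum_indic_mul, Finset.sum_singleton, edgePairing_indic_zero σ E hE0, hG,
          Finset.sum_image σ.injective.injOn]
      have h1 : quadForm σ (indic {0}) = 1 := by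
        simp only [quadForm_indic, invParity, Finset.sum_singleton, Finset.card_singleton]
        simp
      rw [hu, if_pos hl, add_comm (indic E), quadForm_add, h0', h1]
      ring
    · rw [hu, if_neg hl, add_zero, add_zero]
  have hinv : invParity (cycleMap σ) C = invParity σ B + invParity σ E +
      invParity (Equiv.swap (σ 0) (Fin.last m)) G := by
    have e1 : cycleMap σ =
        σ.symm.trans (R.trans (σ.trans ((Equiv.swap (σ 0) (Fin.last m)).trans R))) := rfl
    have e2 : invParity σ.symm C = invParity σ B := by
      have h := invParity_trans σ.symm σ C
      rw [Equiv.symm_trans_self,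
        invParity_eq_zero_of_strictMonoOn (Equiv.refl _) _ (strictMono_id.strictMonoOn _)] at h
      exact CharTwo.add_eq_zero.1 h.symm
    have e3 : Fin.last m ∉ G.image (Equiv.swap (σ 0) (Fin.last m)) := fun h => by
      obtain ⟨a, ha, h⟩ := Finset.mem_image.1 h
      rw [Equiv.swap_apply_eq_iff, Equiv.swap_apply_right] at h
      exact hp (h ▸ ha)
    rw [e1, invParity_trans, e2, invParity_trans, invParity_trans, invParity_trans,
      invParity_eq_zero_of_strictMonoOn R B (finRotate_strictMonoOn B hlast),
      invParity_eq_zero_of_strictMonoOn R _ (finRotate_strictMonoOn _ e3)]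
    ring
  rw [hv, quadForm_add, hpair, hquadU, hinv, quadForm_indic, quadForm_indic, hcardE, hpairs]
  linear_combination CharTwo.add_self_eq_zero (B.card : ZMod 2) +
    CharTwo.add_self_eq_zero (∑ a ∈ B, ∑ b ∈ B, (if a < b then (1 : ZMod 2) else 0))

end

lemma arfBar_eq_zero_of_even_orbit {m : ℕ} (σ : Equiv.Perm (Fin (m + 1))) (j : Fin (m + 1))
    (h0 : ¬ (cycleMap σ).SameCycle 0 j)
    (heven : Even {x | (cycleMap σ).SameCycle j x}.ncard) : arfBar σ = 0 := by
  set C : Finset (Fin (m + 1)) := Finset.univ.filter fun x => (cycleMap σ).SameCycle j x with hdef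
  have hmem : ∀ x, x ∈ C ↔ (cycleMap σ).SameCycle j x := fun x => by simp [hdef]
  have hC : ∀ x, cycleMap σ x ∈ C ↔ x ∈ C := fun x => by
    rw [hmem, hmem, Equiv.Perm.sameCycle_apply_right]
  have hC0 : 0 ∉ C := fun h => h0 ((hmem 0).1 h).symm
  have hcard : {x | (cycleMap σ).SameCycle j x}.ncard = C.card := by
    rw [← Set.ncard_coe_finset]
    congr 1
    ext x
    simp [hmem]
  refine arfBar_eq_zero_of_radical σ (cycleVector σ C) (edgePairing_cycleVector σ C hC hC0) ?_
  rw [quadForm_cycleVector σ C hC hC0]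
  exact invParity_eq_one_of_even_orbit _ j C hmem (hcard ▸ heven)

/-- A relation containing the graph of a permutation contains its orbit relation. -/
lemma rel_of_sameCycle {X : Type} {P : Equiv.Perm X} {r : X → X → Prop} (hr : Equivalence r)
    (h : ∀ a, r a (P a)) {a b : X} (hab : P.SameCycle a b) : r a b := by
  obtain ⟨i, rfl⟩ := hab
  induction i using Int.induction_on with
  | zero => exact hr.refl a
  | succ i ih =>
    rw [add_comm, zpow_add, zpow_one, Equiv.Perm.mul_apply]
    exact hr.trans ih (h _)
  | pred i ih =>
    refine hr.trans ih (hr.symm ?_)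
    have h' := h ((P ^ (-(i : ℤ) - 1)) a)
    rwa [← Equiv.Perm.mul_apply, ← zpow_one_add, add_sub_cancel] at h'

lemma sameCycle_map {X Y : Type} {P : Equiv.Perm X} {Q : Equiv.Perm Y} (i : X → Y)
    (h : ∀ a, Q.SameCycle (i a) (i (P a))) {a b : X} (hab : P.SameCycle a b) :
    Q.SameCycle (i a) (i b) :=
  rel_of_sameCycle (r := fun a b => Q.SameCycle (i a) (i b))
    ⟨fun _ => .refl _ _, fun h => h.symm, fun h h' => h.trans h'⟩ h hab

lemma sameCycle_apply_self {X : Type} (P : Equiv.Perm X) (a : X) : P.SameCycle a (P a) :=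
  Equiv.Perm.sameCycle_apply_right.2 (.refl _ _)

/-- The permutation obtained from `P` by inserting a new point just after `a` in its cycle. -/
noncomputable def insertAfter {X : Type} (P : Equiv.Perm X) (a : X) : Equiv.Perm (Option X) :=
  Equiv.optionCongr P * Equiv.swap (some a) none

lemma insertAfter_none {X : Type} (P : Equiv.Perm X) (a : X) :
    insertAfter P a none = some (P a) := by
  simp [insertAfter]

lemma insertAfter_some {X : Type} (P : Equiv.Perm X) (a b : X) :
    insertAfter P a (some b) = if b = a then none else some (P b) := by
  split_ifs with h
  · simp [insertAfter, h]
  · rw [insertAfter, Equiv.Perm.mul_apply, Equiv.swap_apply_of_ne_of_ne (by simpa using h)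
      (by simp)]
    simp

lemma insertAfter_self {X : Type} (P : Equiv.Perm X) (a : X) :
    insertAfter P a (some a) = none := by
  rw [insertAfter_some, if_pos rfl]

lemma sameCycle_insertAfter {X : Type} (P : Equiv.Perm X) (a : X)
    (h : ∀ x y, P.SameCycle x y) (x y : Option X) : (insertAfter P a).SameCycle x y := by
  have hnone : (insertAfter P a).SameCycle (some a) none := by
    simpa [insertAfter_self] using sameCycle_apply_self (insertAfter P a) (some a)
  have hstep : ∀ b, (insertAfter P a).SameCycle (some b) (some (P b)) := fun b => by
    by_cases hb : b = a
    · subst hb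
      have h' := sameCycle_apply_self (insertAfter P b) none
      rw [insertAfter_none] at h'
      exact hnone.trans h'
    · have h' := sameCycle_apply_self (insertAfter P a) (some b)
      rwa [insertAfter_some, if_neg hb] at h'
  have hsome : ∀ b, (insertAfter P a).SameCycle (some a) (some b) :=
    fun b => sameCycle_map some hstep (h a b)
  have hall : ∀ z, (insertAfter P a).SameCycle (some a) z := fun z => by
    cases z with
    | none => exact hnone
    | some b => exact hsome b
  exact (hall x).symm.trans (hall y)

/-- An irreducible diagram in abstract form: the permutations `R` and `A` run cyclically through
the top and bottom orders of the edges, both starting after the marker `s`. -/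
structure IsDiagram {X : Type} (R A : Equiv.Perm X) (s : X) : Prop where
  top : ∀ a b, R.SameCycle a b
  bottom : ∀ a b, A.SameCycle a b
  irreducible : ∀ S : Set X, s ∉ S → S.Nonempty → (∀ z ∈ S, R z ≠ s → R z ∈ S) →
    (∀ z, A z ∈ S → z ≠ s → z ∈ S) → ∀ z, z ≠ s → z ∈ S

lemma IsDiagram.insert {X : Type} {R A : Equiv.Perm X} {s x z : X} (h : IsDiagram R A s)
    (hx : x ≠ s) (hz : z ≠ s) : IsDiagram (insertAfter R x) (insertAfter A z) (some s) where
  top := sameCycle_insertAfter R x h.top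
  bottom := sameCycle_insertAfter A z h.bottom
  irreducible S hs hne hR hA := by
    have hzS : none ∈ S → some z ∈ S := fun hn =>
      hA (some z) (by rwa [insertAfter_self]) (by simpa using hz)
    have key := h.irreducible (some ⁻¹' S) hs ?_ ?_ ?_
    · have hxS := hR _ (key x hx)
      rw [insertAfter_self] at hxS
      intro y hy
      cases y with
      | none => exact hxS (by simp)
      | some b => exact key b (by simpa using hy)
    · obtain ⟨y, hy⟩ := hne
      cases y with
      | none => exact ⟨z, hzS hy⟩
      | some b => exact ⟨b, hy⟩
    · intro b hb hbs
      have h1 := hR _ hb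
      rw [insertAfter_some] at h1
      split_ifs at h1 with hbx
      · have h2 := hR _ (h1 (by simp))
        rw [insertAfter_none, ← hbx] at h2
        exact h2 (by simpa using hbs)
      · exact h1 (by simpa using hbs)
    · intro b hb hbs
      by_cases hbz : b = z
      · rw [hbz] at hb ⊢
        exact hzS (hA none (by rwa [insertAfter_none]) (by simp))
      · exact hA (some b) (by rwa [insertAfter_some, if_neg hbz]) (by simpa using hbs)

/-- The diagram `(R, A, s)` has rank `c 0` and its closed cycles have lengths `c 1, …, c m`; the
function `f` tells to which cycle the top arc on the left of an edge belongs. -/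
structure HasCycleLengths {X : Type} [Fintype X] (R A : Equiv.Perm X) (s : X) {m : ℕ}
    (f : X → Fin (m + 1)) (c : Fin (m + 1) → ℕ) : Prop extends IsDiagram R A s where
  map_apply : ∀ a, f (R (A a)) = f a
  sameCycle : ∀ a b, f a = f b → (R * A).SameCycle a b
  map_start : f (R s) = 0
  count : ∀ i, ∑ a, (if a ≠ s ∧ f a = i then 1 else 0) = c i + if i = 0 then 1 else 0

/-- Some abstract irreducible diagram has rank `c 0` and closed cycles of lengths `c 1, …, c m`. -/
def Realizable {m : ℕ} (c : Fin (m + 1) → ℕ) : Prop :=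
  ∃ (X : Type) (_ : Fintype X) (R A : Equiv.Perm X) (s : X) (f : X → Fin (m + 1)),
    HasCycleLengths R A s f c

lemma HasCycleLengths.exists_slot {X : Type} [Fintype X] {R A : Equiv.Perm X} {s : X} {m : ℕ}
    {f : X → Fin (m + 1)} {c : Fin (m + 1) → ℕ} (h : HasCycleLengths R A s f c)
    (i : Fin (m + 1)) (hi : 1 ≤ c i) : ∃ z, z ≠ s ∧ A z ≠ s ∧ f z = i := by
  by_contra! hcon
  have hA : ∀ a, a ≠ s → f a = i → A a = s := fun a h1 h2 =>
    by_contra fun h3 => hcon a h1 h3 h2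
  have hcount := h.count i
  by_cases hi0 : i = 0
  · have hle : ∑ a, (if a ≠ s ∧ f a = i then 1 else 0) ≤
        ∑ a, (if a = A.symm s then 1 else 0) := by
      refine Finset.sum_le_sum fun a _ => ?_
      split_ifs with h1 h2 <;> try simp
      exact h2 (by rw [← hA a h1.1 h1.2, Equiv.symm_apply_apply])
    rw [hcount, if_pos hi0, Finset.sum_ite_eq', if_pos (Finset.mem_univ _)] at hle
    omega
  · rw [Finset.sum_eq_zero, if_neg hi0] at hcount
    · omega
    · refine fun a _ => if_neg fun h1 => hi0 ?_
      rw [← h1.2, ← h.map_apply, hA a h1.1 h1.2, h.map_start]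

lemma realizable_one_zero : Realizable (m := 0) fun _ => 1 := by
  have hconn : ∀ a b : Fin 3, (finRotate 3).SameCycle a b := fun a b => by
    have h : ∀ a b : Fin 3, ∃ i : Fin 3, ((finRotate 3) ^ (i : ℕ)) a = b := by decide
    obtain ⟨i, hi⟩ := h a b
    exact ⟨(i : ℕ), by rwa [zpow_natCast]⟩
  have hsq : ∀ a : Fin 3, (finRotate 3 * finRotate 3) ((finRotate 3 * finRotate 3) a) =
      finRotate 3 a := by decide
  refine ⟨Fin 3, inferInstance, finRotate 3, finRotate 3, 2, fun _ => 0,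
    ⟨⟨hconn, hconn, fun S hs hne hR hA => ?_⟩, fun _ => rfl, fun a b _ => ?_, rfl, ?_⟩⟩
  · have h01 : (0 : Fin 3) ∈ S ↔ 1 ∈ S :=
      ⟨fun h => hR 0 h (by decide), fun h => hA 0 h (by decide)⟩
    have h0 : (0 : Fin 3) ∈ S := by
      obtain ⟨y, hy⟩ := hne
      fin_cases y
      · exact hy
      · exact h01.2 hy
      · exact absurd hy hs
    intro z hz
    fin_cases z
    · exact h0
    · exact h01.1 h0
    · exact absurd rfl hz
  · refine sameCycle_map id (fun a => ?_) (hconn a b)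
    have h1 := sameCycle_apply_self (finRotate 3 * finRotate 3) a
    have h2 := h1.trans (sameCycle_apply_self _ _)
    rwa [hsq] at h2
  · intro i
    rw [Fin.fin_one_eq_zero i, Fin.sum_univ_three]
    simp

lemma realizable_one_succ {m : ℕ} (h : Realizable (m := m) fun _ => 1) :
    Realizable (m := m + 1) fun _ => 1 := by
  obtain ⟨X, _, R, A, s, f, h⟩ := h
  obtain ⟨z, hz, hAz, -⟩ := h.exists_slot 0 le_rfl
  have hsome : ∀ a, insertAfter R (A z) (insertAfter A z (some a)) = some (R (A a)) := by
    intro a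
    by_cases ha : a = z
    · rw [ha, insertAfter_self, insertAfter_none]
    · rw [insertAfter_some, if_neg ha, insertAfter_some, if_neg (A.injective.ne ha)]
  have hnone : insertAfter R (A z) (insertAfter A z none) = none := by
    rw [insertAfter_none, insertAfter_self]
  have hlift : ∀ a b, f a = f b →
      (insertAfter R (A z) * insertAfter A z).SameCycle (some a) (some b) := fun a b hab =>
    sameCycle_map some (fun a => by
      simpa [hsome] using sameCycle_apply_self (insertAfter R (A z) * insertAfter A z) (some a))
      (h.sameCycle a b hab)
  refine ⟨Option X, inferInstance, insertAfter R (A z), insertAfter A z, some s,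
    fun p => p.elim (Fin.last (m + 1)) fun a => (f a).castSucc,
    ⟨h.toIsDiagram.insert hAz hz, ?_, ?_, ?_, ?_⟩⟩
  · rintro (_ | a)
    · rw [hnone]
    · rw [hsome]
      simp [h.map_apply]
  · rintro (_ | a) (_ | b) hab
    · exact .refl _ _
    · exact absurd hab.symm (Fin.castSucc_lt_last _).ne
    · exact absurd hab (Fin.castSucc_lt_last _).ne
    · exact hlift a b (Fin.castSucc_injective _ hab)
  · have h1 : insertAfter R (A z) (some s) = some (R s) := by
      rw [insertAfter_some, if_neg hAz.symm]
    simp [h1, h.map_start]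
  · intro i
    rw [Fintype.sum_option]
    induction i using Fin.lastCases with
    | last => simp [(Fin.castSucc_lt_last _).ne]
    | cast i =>
      have := h.count i
      simpa [(Fin.castSucc_lt_last _).ne'] using this

lemma realizable_one (m : ℕ) : Realizable (m := m) fun _ => 1 := by
  induction m with
  | zero => exact realizable_one_zero
  | succ m ih => exact realizable_one_succ ih

lemma Realizable.add_pair {m : ℕ} {c : Fin (m + 1) → ℕ} (h : Realizable c) (hc : ∀ i, 1 ≤ c i)
    (i j : Fin (m + 1)) : Realizable (c + Pi.single i 1 + Pi.single j 1) := by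
  obtain ⟨X, _, R, A, s, f, h⟩ := h
  obtain ⟨y, hy, hAy, rfl⟩ := h.exists_slot i (hc i)
  obtain ⟨z, hz, hAz, rfl⟩ := h.exists_slot j (hc j)
  set R' := insertAfter (insertAfter R (A y)) none with hR'
  set A' := insertAfter (insertAfter A z) none with hA'
  set rep : Option (Option X) → X := fun p => p.elim z fun q => q.elim y id with hrep
  have happly : ∀ a, R' (A' (some (some a))) = if a = z then none else
      if a = y then some none else some (some (R (A a))) := by
    intro a
    simp only [hR', hA', insertAfter_some]
    by_cases haz : a = z
    · simp [haz, insertAfter_some]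
    · by_cases hay : a = y
      · subst hay
        simp [haz, insertAfter_some]
      · simp [haz, hay, insertAfter_some]
  have hnew : R' (A' (some none)) = some (some (R (A y))) := by
    simp [hR', hA', insertAfter_some, insertAfter_none]
  have hnew' : R' (A' none) = if z = y then some none else some (some (R (A z))) := by
    by_cases hzy : z = y <;> simp [hR', hA', insertAfter_some, insertAfter_none, hzy]
  have hstep : ∀ p q, R' (A' p) = q → (R' * A').SameCycle p q := fun p q hpq =>
    hpq ▸ sameCycle_apply_self (R' * A') p
  have hlift : ∀ a, (R' * A').SameCycle (some (some a)) (some (some (R (A a)))) := by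
    intro a
    by_cases haz : a = z
    · have h1 := hstep _ _ (happly a)
      rw [if_pos haz] at h1
      refine h1.trans ?_
      have h2 := hstep _ _ hnew'
      split_ifs at h2 with hzy
      · rw [haz, hzy]
        exact h2.trans (hstep _ _ hnew)
      · rwa [haz]
    · have h1 := hstep _ _ (happly a)
      rw [if_neg haz] at h1
      split_ifs at h1 with hay
      · rw [hay] at h1 ⊢
        exact h1.trans (hstep _ _ hnew)
      · exact h1
  have hrepcycle : ∀ p, (R' * A').SameCycle p (some (some (rep p))) := by
    rintro (_ | _ | a)
    · have h1 := hstep _ _ (happly z)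
      rw [if_pos rfl] at h1
      exact h1.symm
    · exact (hstep _ _ hnew).trans (hlift y).symm
    · exact .refl _ _
  refine ⟨Option (Option X), inferInstance, R', A', some (some s), fun p => f (rep p),
    ⟨(h.toIsDiagram.insert hAy hz).insert (by simp) (by simp), ?_, ?_, ?_, ?_⟩⟩
  · rintro (_ | _ | a)
    · rw [hnew']
      by_cases hzy : z = y <;> simp [hrep, hzy, h.map_apply]
    · rw [hnew]
      simp [hrep, h.map_apply]
    · rw [happly]
      by_cases haz : a = z
      · simp [hrep, haz]
      · by_cases hay : a = y
        · subst hay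
          simp [hrep, haz]
        · simp [hrep, haz, hay, h.map_apply]
  · intro p q hpq
    exact (hrepcycle p).trans ((sameCycle_map (fun a => some (some a)) hlift
      (h.sameCycle _ _ hpq)).trans (hrepcycle q).symm)
  · have h1 : R' (some (some s)) = some (some (R s)) := by
      simp [hR', insertAfter_some, hAy.symm]
    simp [h1, hrep, h.map_start]
  · intro i
    have hi := h.count i
    rw [Fintype.sum_option, Fintype.sum_option]
    simp only [hrep, Option.elim_none, Option.elim_some, id, ne_eq, Option.some.injEq,
      reduceCtorEq, not_false_eq_true, true_and] at hi ⊢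
    rw [hi]
    simp only [Pi.add_apply, Pi.single_apply, eq_comm (a := f _)]
    ring

lemma realizable_of_sum_eq {m : ℕ} (k : ℕ) (d : Fin (m + 1) → ℕ) (hd : ∑ i, d i = 2 * k) :
    Realizable fun i => 1 + d i := by
  have hpick : ∀ e : Fin (m + 1) → ℕ, 0 < ∑ i, e i →
      ∃ (i : Fin (m + 1)) (e' : Fin (m + 1) → ℕ), e = e' + Pi.single i 1 ∧ ∑ i, e i = ∑ i, e' i + 1 := by
    intro e he
    obtain ⟨i, -, hi⟩ := Finset.exists_ne_zero_of_sum_ne_zero he.ne'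
    have h1 : e = (e - Pi.single i 1) + Pi.single i 1 := by
      funext j
      by_cases hj : j = i
      · subst hj
        simp
        omega
      · simp [hj]
    refine ⟨i, _, h1, ?_⟩
    conv_lhs => rw [h1]
    simp [Finset.sum_add_distrib]
  induction k generalizing d with
  | zero =>
    have h0 : ∀ i, d i = 0 := by simpa using hd
    simpa [h0] using realizable_one m
  | succ k ih =>
    obtain ⟨i, d', rfl, h1⟩ := hpick d (by omega)
    obtain ⟨j, d'', rfl, h2⟩ := hpick d' (by omega)
    have h := (ih d'' (by omega)).add_pair (fun _ => by omega) j i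
    convert h using 1
    funext t
    simp only [Pi.add_apply]
    ring

/-- `T` lists, in cyclic order, the points met by iterating `P` from `s` before returning to `s`. -/
structure Enumerates {X : Type} (P : Equiv.Perm X) (s : X) {k : ℕ} (T : Fin (k + 1) → X) :
    Prop where
  injective : Function.Injective T
  ne_iff : ∀ x, x ≠ s ↔ ∃ i, T i = x
  zero : T 0 = P s
  succ : ∀ i : Fin k, P (T i.castSucc) = T i.succ
  last : P (T (Fin.last k)) = s

lemma exists_enumerates {X : Type} [Fintype X] (P : Equiv.Perm X) (s : X) {k : ℕ}
    (hP : ∀ a b, P.SameCycle a b) (hcard : Fintype.card X = k + 2) :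
    ∃ T : Fin (k + 1) → X, Enumerates P s T := by
  have hcyc : P.IsCycleOn ((Finset.univ : Finset X) : Set X) :=
    ⟨by simp, fun a _ b _ => hP a b⟩
  have hs : s ∈ (Finset.univ : Finset X) := Finset.mem_univ s
  have hne : ∀ i : Fin (k + 1), (P ^ (i.val + 1)) s ≠ s := fun i hi => by
    rw [hcyc.pow_apply_eq hs, Finset.card_univ, hcard] at hi
    have := Nat.le_of_dvd (by omega) hi
    omega
  refine ⟨fun i => (P ^ (i.val + 1)) s, fun i j hij => ?_, fun x => ⟨fun hx => ?_, ?_⟩, by simp,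
    fun i => ?_, ?_⟩
  · have h1 := (hcyc.pow_apply_eq_pow_apply hs).1 hij
    rw [Finset.card_univ, hcard] at h1
    have h2 := Nat.ModEq.eq_of_lt_of_lt h1 (by omega) (by omega)
    exact Fin.ext (by omega)
  · obtain ⟨t, ht, rfl⟩ := hcyc.exists_pow_eq hs (Finset.mem_univ x)
    rw [Finset.card_univ, hcard] at ht
    have h0 : t ≠ 0 := fun h => hx (by simp [h])
    exact ⟨⟨t - 1, by omega⟩, by simp [Nat.sub_add_cancel (Nat.one_le_iff_ne_zero.2 h0)]⟩
  · rintro ⟨i, rfl⟩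
    exact hne i
  · rw [← Equiv.Perm.mul_apply, ← pow_succ']
    rfl
  · rw [← Equiv.Perm.mul_apply, ← pow_succ', hcyc.pow_apply_eq hs, Finset.card_univ, hcard]
    simp

lemma Enumerates.ne {X : Type} {P : Equiv.Perm X} {s : X} {k : ℕ} {T : Fin (k + 1) → X}
    (h : Enumerates P s T) (i : Fin (k + 1)) : T i ≠ s :=
  (h.ne_iff _).2 ⟨i, rfl⟩

lemma Enumerates.apply_finRotate {X : Type} {P : Equiv.Perm X} {s : X} {k : ℕ}
    {T : Fin (k + 1) → X} (h : Enumerates P s T) {i : Fin (k + 1)} (hi : i ≠ Fin.last k) :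
    T (finRotate (k + 1) i) = P (T i) := by
  induction i using Fin.lastCases with
  | last => exact absurd rfl hi
  | cast i => rw [h.succ, finRotate_apply, Fin.coeSucc_eq_succ]

lemma Enumerates.exists_perm {X : Type} {R A : Equiv.Perm X} {s : X} {k : ℕ}
    {T B : Fin (k + 1) → X} (hT : Enumerates R s T) (hB : Enumerates A s B) :
    ∃ σ : Equiv.Perm (Fin (k + 1)), ∀ j, T (σ j) = B j := by
  choose g hg using fun j => (hT.ne_iff (B j)).1 (hB.ne j)
  have hinj : Function.Injective g := fun i j hij => hB.injective (by rw [← hg, ← hg, hij])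
  exact ⟨Equiv.ofBijective g (Finite.injective_iff_bijective.1 hinj), hg⟩

lemma IsDiagram.rauzyIrreducible {X : Type} {R A : Equiv.Perm X} {s : X} (h : IsDiagram R A s)
    {k : ℕ} {T B : Fin (k + 1) → X} (hT : Enumerates R s T) (hB : Enumerates A s B)
    {σ : Equiv.Perm (Fin (k + 1))} (hσ : ∀ j, T (σ j) = B j) : rauzyIrreducible σ := by
  intro q hq hqk heq
  have hmem : ∀ i : Fin (k + 1), k + 1 - q ≤ i.val ↔ ∃ j : Fin (k + 1), j.val < q ∧ σ j = i := by
    intro i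
    have := Finset.ext_iff.1 heq i
    simpa [eq_comm] using this.symm
  have key := h.irreducible {x | ∃ j : Fin (k + 1), j.val < q ∧ B j = x} ?_ ?_ ?_ ?_ _
    (hB.ne (Fin.last k))
  · obtain ⟨j, hj, hjl⟩ := key
    rw [hB.injective hjl, Fin.val_last] at hj
    omega
  · rintro ⟨j, -, hj⟩
    exact hB.ne j hj
  · exact ⟨B 0, 0, hq, rfl⟩
  · rintro _ ⟨j, hj, rfl⟩ hne
    have h1 := (hmem (σ j)).2 ⟨j, hj, rfl⟩
    rw [← hσ] at hne ⊢
    generalize σ j = i at hne h1 ⊢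
    induction i using Fin.lastCases with
    | last => exact absurd hT.last hne
    | cast i =>
      obtain ⟨j', hj', h2⟩ := (hmem i.succ).1 (by simp at h1 ⊢; omega)
      exact ⟨j', hj', by rw [hT.succ, ← h2, hσ]⟩
  · rintro z ⟨j, hj, hjz⟩ hz
    obtain ⟨i, rfl⟩ := (hB.ne_iff z).1 hz
    induction i using Fin.lastCases with
    | last => exact absurd (hjz.trans hB.last) (hB.ne j)
    | cast i =>
      rw [hB.succ] at hjz
      rw [hB.injective hjz] at hj
      exact ⟨i.castSucc, by simp at hj ⊢; omega, rfl⟩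

lemma Enumerates.apply_cycleMap {X : Type} {R A : Equiv.Perm X} {s : X} {k : ℕ}
    {T B : Fin (k + 1) → X} (hT : Enumerates R s T) (hB : Enumerates A s B)
    {σ : Equiv.Perm (Fin (k + 1))} (hσ : ∀ j, T (σ j) = B j) (j : Fin (k + 1)) :
    T (cycleMap σ j) = if R (A (T j)) = s then R (A s) else R (A (T j)) := by
  obtain ⟨b, rfl⟩ := σ.surjective j
  rw [cycleMap_apply, hσ]
  induction b using Fin.lastCases with
  | last =>
    rw [finRotate_last, Equiv.swap_apply_left, finRotate_last, hB.last, hT.zero, if_neg]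
    rw [← hT.zero]
    exact hT.ne 0
  | cast i =>
    have hrot : finRotate (k + 1) i.castSucc = i.succ := by
      rw [finRotate_apply, Fin.coeSucc_eq_succ]
    have h0 : σ i.succ ≠ σ 0 := σ.injective.ne (Fin.succ_ne_zero i)
    rw [hrot, hB.succ, ← hσ]
    by_cases hl : σ i.succ = Fin.last k
    · rw [hl, Equiv.swap_apply_right, hT.last, if_pos rfl, hT.apply_finRotate (hl ▸ h0.symm), hσ,
        hB.zero]
    · rw [Equiv.swap_apply_of_ne_of_ne h0 hl, hT.apply_finRotate hl, if_neg]
      rw [← hT.apply_finRotate hl]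
      exact hT.ne _

lemma HasCycleLengths.card_eq {X : Type} [Fintype X] {R A : Equiv.Perm X} {s : X} {m : ℕ}
    {f : X → Fin (m + 1)} {c : Fin (m + 1) → ℕ} (h : HasCycleLengths R A s f c) :
    Fintype.card X = ∑ i, c i + 2 := by
  have h1 : ∑ i, ∑ a, (if a ≠ s ∧ f a = i then 1 else 0) = ∑ i, c i + 1 := by
    simp [h.count, Finset.sum_add_distrib]
  rw [Finset.sum_comm] at h1
  have h2 : ∀ a, ∑ i, (if a ≠ s ∧ f a = i then 1 else 0) = if a ≠ s then 1 else 0 := by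
    intro a
    by_cases ha : a = s <;> simp [ha]
  rw [Finset.sum_congr rfl fun a _ => h2 a, ← Finset.card_filter, Finset.filter_ne',
    Finset.card_erase_of_mem (Finset.mem_univ _), Finset.card_univ] at h1
  have := Fintype.card_pos_iff.2 ⟨s⟩
  omega

lemma HasCycleLengths.ncard_eq {X : Type} [Fintype X] {R A : Equiv.Perm X} {s : X} {m : ℕ}
    {f : X → Fin (m + 1)} {c : Fin (m + 1) → ℕ} (h : HasCycleLengths R A s f c) {k : ℕ}
    {T : Fin (k + 1) → X} (hT : Enumerates R s T) (i : Fin (m + 1)) :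
    {j | f (T j) = i}.ncard = c i + if i = 0 then 1 else 0 := by
  rw [← h.count, ← Finset.card_filter, ← Set.ncard_coe_finset,
    ← Set.ncard_image_of_injective _ hT.injective]
  congr 1
  ext x
  simp only [Set.mem_image, Set.mem_ofPred_eq, Finset.coe_filter, Finset.mem_univ, true_and,
    hT.ne_iff]
  constructor
  · rintro ⟨j, hj, rfl⟩
    exact ⟨⟨j, rfl⟩, hj⟩
  · rintro ⟨⟨j, rfl⟩, hj⟩
    exact ⟨j, hj, rfl⟩

lemma HasCycleLengths.sameCycle_iff {X : Type} [Fintype X] {R A : Equiv.Perm X} {s : X} {m : ℕ}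
    {f : X → Fin (m + 1)} {c : Fin (m + 1) → ℕ} (h : HasCycleLengths R A s f c) {k : ℕ}
    (hk : k ≠ 0) {T B : Fin (k + 1) → X} (hT : Enumerates R s T) (hB : Enumerates A s B)
    {σ : Equiv.Perm (Fin (k + 1))} (hσ : ∀ j, T (σ j) = B j) (i j : Fin (k + 1)) :
    (cycleMap σ).SameCycle i j ↔ f (T i) = f (T j) := by
  have hstep := hT.apply_cycleMap hB hσ
  refine ⟨rel_of_sameCycle (r := fun i j => f (T i) = f (T j))
    ⟨fun _ => rfl, fun h => h.symm, fun h h' => h.trans h'⟩ fun i => ?_, fun hij => ?_⟩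
  · rw [hstep]
    split_ifs with hs
    · rw [h.map_apply, ← hs, h.map_apply]
    · rw [h.map_apply]
  have hs : R (A s) ≠ s := fun hs => by
    have hall := h.irreducible {A s} (by rw [← hB.zero]; exact (hB.ne 0).symm) ⟨_, rfl⟩
      (by rintro _ rfl h'; exact absurd hs h') fun z hz hzs => absurd (A.injective hz) hzs
    have h0 := (hall _ (hT.ne 0)).trans (hall _ (hT.ne (Fin.last k))).symm
    exact hk (by simpa using (congrArg Fin.val (hT.injective h0)).symm)
  have hne : ∀ x, (if x = s then R (A s) else x) ≠ s := fun x => by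
    split_ifs with hx
    · exact hs
    · exact hx
  choose g hg using fun x => (hT.ne_iff _).1 (hne x)
  have hgT : ∀ j, g (T j) = j := fun j => hT.injective (by rw [hg, if_neg (hT.ne j)])
  rw [← hgT i, ← hgT j]
  refine sameCycle_map (P := R * A) g (fun a => ?_) (h.sameCycle _ _ hij)
  rw [Equiv.Perm.mul_apply]
  by_cases ha : a = s
  · have : g (R (A s)) = g s := hT.injective (by rw [hg, hg, if_neg hs, if_pos rfl])
    rw [ha, this]
  · have : cycleMap σ (g a) = g (R (A a)) :=
      hT.injective (by rw [hstep, hg, hg, if_neg ha])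
    rw [← this]
    exact sameCycle_apply_self _ _

lemma rauzyRank_of_sameCycle_iff {m k : ℕ} {σ : Equiv.Perm (Fin (k + 1))} {c : Fin (m + 1) → ℕ}
    {φ : Fin (k + 1) → Fin (m + 1)} (hφ : ∀ i j, (cycleMap σ).SameCycle i j ↔ φ i = φ j)
    (h0 : φ 0 = 0) (hcard : ∀ i, {j | φ j = i}.ncard = c i + if i = 0 then 1 else 0) :
    rauzyRank σ = c 0 := by
  simp only [rauzyRank, hφ, h0, eq_comm (a := (0 : Fin (m + 1)))]
  simp [hcard]

lemma rauzyLambda_of_sameCycle_iff {m k : ℕ} {σ : Equiv.Perm (Fin (k + 1))}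
    {c : Fin (m + 1) → ℕ} {φ : Fin (k + 1) → Fin (m + 1)} (hc : ∀ i, 1 ≤ c i)
    (hφ : ∀ i j, (cycleMap σ).SameCycle i j ↔ φ i = φ j)
    (h0 : φ 0 = 0) (hcard : ∀ i, {j | φ j = i}.ncard = c i + if i = 0 then 1 else 0) :
    rauzyLambda σ = Finset.univ.val.map fun i : Fin m => c i.succ := by
  simp only [rauzyLambda, hφ, h0]
  set F := Finset.univ.filter fun j => (∀ x, φ j = φ x → j ≤ x) ∧ ¬ 0 = φ j with hF
  have hmem : ∀ j, j ∈ F ↔ (∀ x, φ j = φ x → j ≤ x) ∧ ¬ 0 = φ j := by simp [hF]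
  have hinj : Set.InjOn φ F := fun i hi j hj hij =>
    le_antisymm (((hmem i).1 hi).1 j hij) (((hmem j).1 hj).1 i hij.symm)
  have himage : F.image φ = Finset.univ.image Fin.succ := by
    ext i
    simp only [Finset.mem_image, Finset.mem_univ, true_and, Fin.exists_succ_eq]
    constructor
    · rintro ⟨j, hj, rfl⟩
      exact fun h => ((hmem j).1 hj).2 h.symm
    · intro hi
      have hne : (Finset.univ.filter fun j => φ j = i).Nonempty := by
        rw [← Finset.coe_nonempty, ← Set.ncard_pos]
        have := hc i
        simp only [Finset.coe_filter, Finset.mem_univ, true_and, hcard]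
        omega
      obtain ⟨j, hj, hmin⟩ := Finset.exists_min_image _ id hne
      simp only [Finset.mem_filter, Finset.mem_univ, true_and, id] at hj hmin
      exact ⟨j, (hmem j).2 ⟨fun x hx => hmin x (by rw [← hx, hj]), by rw [hj]; exact Ne.symm hi⟩,
        hj⟩
  have hval : F.val.map φ = Finset.univ.val.map Fin.succ := by
    rw [← Finset.image_val_of_injOn hinj, himage,
      Finset.image_val_of_injOn (Fin.succ_injective m).injOn]
  calc F.val.map (fun j => {x | φ j = φ x}.ncard) = F.val.map (fun j => c (φ j)) := by
        refine Multiset.map_congr rfl fun j hj => ?_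
        have hj0 : φ j ≠ 0 := Ne.symm ((hmem j).1 hj).2
        have := hcard (φ j)
        rw [if_neg hj0, add_zero] at this
        simpa only [eq_comm] using this
    _ = (F.val.map φ).map c := by rw [Multiset.map_map]; rfl
    _ = _ := by rw [hval, Multiset.map_map]; rfl

lemma Realizable.exists_perm {m k : ℕ} {c : Fin (m + 1) → ℕ} (h : Realizable c)
    (hc : ∀ i, 1 ≤ c i) (hk : ∑ i, c i = k) : ∃ σ : Equiv.Perm (Fin (k + 1)),
      rauzyIrreducible σ ∧ rauzyRank σ = c 0 ∧
        rauzyLambda σ = Finset.univ.val.map fun i : Fin m => c i.succ := by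
  obtain ⟨X, _, R, A, s, f, h⟩ := h
  have hX : Fintype.card X = k + 2 := hk ▸ h.card_eq
  have hk0 : k ≠ 0 := by
    have h1 := hc 0
    have h2 := Finset.single_le_sum (fun i _ => Nat.zero_le (c i)) (Finset.mem_univ 0)
    omega
  obtain ⟨T, hT⟩ := exists_enumerates R s h.top hX
  obtain ⟨B, hB⟩ := exists_enumerates A s h.bottom hX
  obtain ⟨σ, hσ⟩ := hT.exists_perm hB
  have hφ := h.sameCycle_iff hk0 hT hB hσ
  have h0 : f (T 0) = 0 := by rw [hT.zero, h.map_start]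
  exact ⟨σ, h.rauzyIrreducible hT hB hσ, rauzyRank_of_sameCycle_iff hφ h0 (h.ncard_eq hT),
    rauzyLambda_of_sameCycle_iff hc hφ h0 (h.ncard_eq hT)⟩

lemma even_sum_pred_iff (S : Multiset ℕ) (h : ∀ c ∈ S, 1 ≤ c) :
    Even (S.map fun c => c - 1).sum ↔ Even (Multiset.card (S.filter fun c => Even c)) := by
  induction S using Multiset.induction_on with
  | empty => simp
  | cons c S ih =>
    have h1 := h c (Multiset.mem_cons_self c S)
    have ih := ih fun x hx => h x (Multiset.mem_cons_of_mem hx)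
    have hc : Even (c - 1) ↔ ¬ Even c := by
      rw [Nat.even_sub h1]
      simp
    rw [Multiset.map_cons, Multiset.sum_cons, Nat.even_add, ih, hc]
    by_cases hev : Even c
    · rw [Multiset.filter_cons_of_pos _ hev, Multiset.card_cons, Nat.even_add_one]
      tauto
    · rw [Multiset.filter_cons_of_neg _ hev]
      tauto

/-- Every `(λ, r)` with an even number of even entries is the cycle invariant of an irreducible
permutation. -/
lemma exists_rauzyIrreducible (lam : Multiset ℕ) (r : ℕ) {k : ℕ}
    (hpos : ∀ c ∈ r ::ₘ lam, 1 ≤ c) (hsum : r + lam.sum = k)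
    (heven : Even (Multiset.card ((r ::ₘ lam).filter fun c => Even c))) :
    ∃ σ : Equiv.Perm (Fin (k + 1)), rauzyIrreducible σ ∧ rauzyLambda σ = lam ∧
      rauzyRank σ = r := by
  have hlist := lam.coe_toList
  generalize lam.toList = l at hlist
  subst hlist
  set c : Fin (l.length + 1) → ℕ := Fin.cons r l.get with hcdef
  have hmap : (Finset.univ.val.map fun i : Fin l.length => c i.succ) = (l : Multiset ℕ) := by
    simp [hcdef, Fin.univ_val_map]
  have hmap' : Finset.univ.val.map c = r ::ₘ (l : Multiset ℕ) := by
    rw [Fin.univ_val_map, List.ofFn_succ, ← Multiset.cons_coe, ← hmap, Fin.univ_val_map]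
    rfl
  have hc : ∀ i, 1 ≤ c i := fun i =>
    hpos _ (hmap' ▸ Multiset.mem_map_of_mem c (Finset.mem_univ i))
  have hd : Even (∑ i, (c i - 1)) := by
    rw [← even_sum_pred_iff _ hpos, ← hmap', Multiset.map_map] at heven
    exact heven
  obtain ⟨q, hq⟩ := hd
  have hreal : Realizable c := by
    convert realizable_of_sum_eq q (fun i => c i - 1) (by omega) using 2 with i
    have := hc i
    omega
  have hk : ∑ i, c i = k := by
    rw [← hsum, ← Multiset.sum_cons, ← hmap']
    rfl
  obtain ⟨σ, h1, h2, h3⟩ := hreal.exists_perm hc hk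
  exact ⟨σ, h1, h3.trans hmap, h2⟩
/-- For an invariant `(λ, r)` with a positive even number of even entries there exists an
irreducible permutation realizing it, and every such permutation has `Ā(σ) = 0`. -/
theorem class_with_even_entries {n : ℕ} (hn : 9 ≤ n) (lam : Multiset ℕ)
    (hlam : ∀ c ∈ lam, 2 ≤ c) (r : ℕ) (hr1 : 1 ≤ r)
    (hsum : r + lam.sum = n - 1)
    (heven : Even (Multiset.card ((r ::ₘ lam).filter fun c => Even c)))
    (hpos : 0 < Multiset.card ((r ::ₘ lam).filter fun c => Even c)) :
    (∃ σ : Equiv.Perm (Fin n), rauzyIrreducible σ ∧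
      rauzyLambda σ = lam ∧ rauzyRank σ = r) ∧
    ∀ σ : Equiv.Perm (Fin n), rauzyIrreducible σ →
      rauzyLambda σ = lam → rauzyRank σ = r → arfBar σ = 0 := by
  obtain ⟨k, rfl⟩ : ∃ k, n = k + 1 := ⟨n - 1, by omega⟩
  refine ⟨exists_rauzyIrreducible lam r ?_ hsum heven, fun σ _ hσ _ => ?_⟩
  · intro c hc
    obtain rfl | hc := Multiset.mem_cons.1 hc
    · exact hr1
    · exact one_le_two.trans (hlam c hc)
  · obtain ⟨c, hc, hceven⟩ : ∃ c ∈ lam, Even c := by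
      by_contra! hcon
      have h1 : Multiset.card ((r ::ₘ lam).filter fun c => Even c) ≤ 1 := by
        rw [Multiset.filter_cons, Multiset.filter_eq_nil.2 fun c hc => by simpa using hcon c hc]
        split_ifs <;> simp
      obtain ⟨q, hq⟩ := heven
      omega
    rw [← hσ, rauzyLambda] at hc
    obtain ⟨j, hj, rfl⟩ := Multiset.mem_map.1 hc
    rw [Finset.mem_val, Finset.mem_filter] at hj
    exact arfBar_eq_zero_of_even_orbit σ j hj.2.2 hceven

end Rauzy
end

section
/- Let n ≥ 2. The identity permutation id_n is the unique permutation σ of {1,…,n} that is connected to id_n and satisfies σ(n−1) = n−1 and σ(n) = n. -/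
open scoped Classical

namespace Rauzy

/-- The initial block `{0,…,i-1}` of `Fin n` as a subtype. -/
def blockEquiv (n i : ℕ) (h : i ≤ n) : Fin i ≃ {j : Fin n // j.val < i} where
  toFun x := ⟨⟨x.val, lt_of_lt_of_le x.isLt h⟩, x.isLt⟩
  invFun x := ⟨x.1.val, x.2⟩
  left_inv _ := rfl
  right_inv _ := rfl

/-- The final block `{a,…,n-1}` of `Fin n` as a subtype. -/
def tailEquiv (n a : ℕ) (h : a ≤ n) : Fin (n - a) ≃ {j : Fin n // a ≤ j.val} where
  toFun x := ⟨⟨a + x.val, by have := x.isLt; omega⟩, by simp⟩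
  invFun x := ⟨x.1.val - a, by have := x.1.isLt; have := x.2; omega⟩
  left_inv x := by apply Fin.ext; simp
  right_inv x := by apply Subtype.ext; apply Fin.ext; have := x.2; simp; omega

/-- Cyclically rotate the first `i` elements of `Fin n` down by one
(`0 ↦ i-1`, `j ↦ j-1` for `1 ≤ j ≤ i-1`), fixing the others. -/
def rotDownBelow (n i : ℕ) (h : i ≤ n) : Equiv.Perm (Fin n) :=
  Equiv.Perm.extendDomain (finRotate i)⁻¹ (blockEquiv n i h)

/-- Cyclically rotate the last `n - a` elements of `Fin n` down by one
(`a ↦ n-1`, `j ↦ j-1` for `a+1 ≤ j ≤ n-1`), fixing the others. -/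
def rotDownFrom (n a : ℕ) (h : a ≤ n) : Equiv.Perm (Fin n) :=
  Equiv.Perm.extendDomain (finRotate (n - a))⁻¹ (tailEquiv n a h)

/-- The Rauzy operator `L`: `L(σ) = γ_L(σ(n)) ∘ σ`. -/
def rauzyL {n : ℕ} (σ : Equiv.Perm (Fin n)) : Equiv.Perm (Fin n) :=
  if h : 0 < n then
    rotDownBelow n (σ ⟨n - 1, by omega⟩).val (σ ⟨n - 1, by omega⟩).isLt.le * σ
  else σ

/-- The Rauzy operator `R`: `R(σ) = σ ∘ δ_R(σ⁻¹(1))`. -/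
def rauzyR {n : ℕ} (σ : Equiv.Perm (Fin n)) : Equiv.Perm (Fin n) :=
  if h : 0 < n then σ * rotDownFrom n ((σ⁻¹ ⟨0, h⟩).val + 1) (σ⁻¹ ⟨0, h⟩).isLt
  else σ

/-- One step of the Rauzy dynamics: apply `L` or `R`. -/
def rauzyStep {n : ℕ} (σ τ : Equiv.Perm (Fin n)) : Prop :=
  τ = rauzyL σ ∨ τ = rauzyR σ

/-- `τ` is obtained from `σ` by a finite sequence of applications of `L` and `R`. -/
def rauzyReach {n : ℕ} (σ τ : Equiv.Perm (Fin n)) : Prop :=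
  Relation.ReflTransGen rauzyStep σ τ

/-- Two permutations are connected (are in the same Rauzy class) if one can be obtained
from the other by a finite sequence of applications of `L` and `R`. -/
def rauzyConnected {n : ℕ} (σ τ : Equiv.Perm (Fin n)) : Prop :=
  rauzyReach σ τ ∨ rauzyReach τ σ

/-- Two edges, given by their endpoints, share an endpoint. -/
def Meets (e f : ℕ × ℕ) : Prop :=
  e.1 = f.1 ∨ e.1 = f.2 ∨ e.2 = f.1 ∨ e.2 = f.2

theorem Meets.symm {e f : ℕ × ℕ} (h : Meets e f) : Meets f e := by
  unfold Meets at *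
  grind

/-- The edges of a finite family are independent (they form a forest without multiple edges):
every labelling of the edges by `Bool` is the coboundary of a labelling of the vertices. -/
def IndepEdges {ι : Type*} (e : ι → ℕ × ℕ) : Prop :=
  ∀ g : ι → Bool, ∃ h : ℕ → Bool, ∀ i, xor (h (e i).1) (h (e i).2) = g i

/-- The edges `e` represent `σ`: they are independent, and two of them meet exactly when the
corresponding pair of positions is not an inversion of `σ`. -/
def Represents {n : ℕ} (e : Fin n → ℕ × ℕ) (σ : Equiv.Perm (Fin n)) : Prop :=
  IndepEdges e ∧ ∀ i j, i ≠ j → (Meets (e i) (e j) ↔ (i < j ↔ σ i < σ j))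

theorem IndepEdges.comp_equiv {ι : Type*} {e : ι → ℕ × ℕ} (he : IndepEdges e)
    (δ : Equiv.Perm ι) : IndepEdges (e ∘ δ) := by
  intro g
  obtain ⟨h, hh⟩ := he (g ∘ δ.symm)
  exact ⟨h, fun i => by simpa using hh (δ i)⟩

/-- Two meeting edges of an independent family have a common vertex `u`, and their third
vertices `v`, `w` are such that no other edge lies within `{u, v, w}`. -/
theorem IndepEdges.exists_common_vertex {ι : Type*} {e : ι → ℕ × ℕ} (he : IndepEdges e)
    {a b : ι} (hab : a ≠ b) (hm : Meets (e a) (e b)) :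
    ∃ u v w : ℕ, u ≠ v ∧ u ≠ w ∧ v ≠ w ∧ (e a = (u, v) ∨ e a = (v, u)) ∧
      (e b = (u, w) ∨ e b = (w, u)) ∧
      ∀ c, c ≠ a → c ≠ b → ∃ h : ℕ → Bool, h u = h v ∧ h u = h w ∧ h (e c).1 ≠ h (e c).2 := by
  obtain ⟨ha, hha⟩ := he (fun i => decide (i = a))
  obtain ⟨hb, hhb⟩ := he (fun i => decide (i = b))
  have h1 := hha a
  have h2 := hha b
  have h3 := hhb a
  have h4 := hhb b
  have key : ∀ c, c ≠ a → c ≠ b → ∃ h : ℕ → Bool,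
      h (e a).1 = h (e a).2 ∧ h (e b).1 = h (e b).2 ∧ h (e c).1 ≠ h (e c).2 := by
    intro c hca hcb
    obtain ⟨h, hh⟩ := he (fun i => decide (i = c))
    have h1 := hh a
    have h2 := hh b
    have h3 := hh c
    exact ⟨h, by simpa [Ne.symm hca] using h1, by simpa [Ne.symm hcb] using h2,
      by simpa using h3⟩
  rcases hea : e a with ⟨x, y⟩
  rcases heb : e b with ⟨z, t⟩
  simp only [hea, heb, Meets] at h1 h2 h3 h4 hm key ⊢
  simp only [hab, hab.symm, decide_true, decide_false] at h1 h2 h3 h4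
  rcases hm with rfl | rfl | rfl | rfl
  · refine ⟨x, y, t, ?_, ?_, ?_, by simp, by simp, fun c h h' =>
      (key c h h').imp fun k hk => ?_⟩ <;> grind
  · refine ⟨x, y, z, ?_, ?_, ?_, by simp, by simp, fun c h h' =>
      (key c h h').imp fun k hk => ?_⟩ <;> grind
  · refine ⟨y, x, t, ?_, ?_, ?_, by simp, by simp, fun c h h' =>
      (key c h h').imp fun k hk => ?_⟩ <;> grind
  · refine ⟨y, x, z, ?_, ?_, ?_, by simp, by simp, fun c h h' =>
      (key c h h').imp fun k hk => ?_⟩ <;> grind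

/-- Sliding the edge `b` along the edge `a`. -/
theorem IndepEdges.exists_slide {ι : Type*} {e : ι → ℕ × ℕ} (he : IndepEdges e)
    {a b : ι} (hab : a ≠ b) (hm : Meets (e a) (e b)) :
    ∃ e' : ι → ℕ × ℕ, IndepEdges e' ∧ (∀ c, c ≠ b → e' c = e c) ∧ Meets (e' a) (e' b) ∧
      ∀ c, c ≠ a → c ≠ b →
        (Meets (e' c) (e' b) ↔ ¬(Meets (e c) (e a) ↔ Meets (e c) (e b))) := by
  obtain ⟨u, v, w, huv, huw, hvw, ha, hb, hc⟩ := he.exists_common_vertex hab hm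
  have hne : ∀ c, c ≠ b → Function.update e b (v, w) c = e c := fun c hcb => by simp [hcb]
  refine ⟨Function.update e b (v, w), ?_, hne, ?_, ?_⟩
  · intro g
    obtain ⟨h, hh⟩ := he (Function.update g b (xor (g a) (g b)))
    refine ⟨h, fun i => ?_⟩
    by_cases hib : i = b
    · subst hib
      have h1 := hh a
      have h2 := hh i
      simp only [Function.update_self, Function.update_of_ne hab] at h1 h2 ⊢
      rcases ha with ha | ha <;> rcases hb with hb | hb <;> simp only [ha, hb] at h1 h2 <;>
        (revert h1 h2; cases h u <;> cases h v <;> cases h w <;> cases g a <;> cases g i <;> simp)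
    · simpa [hib] using hh i
  · rw [hne a hab]
    simp only [Function.update_self, Meets]
    grind
  · intro c hca hcb
    obtain ⟨h, h1, h2, h3⟩ := hc c hca hcb
    rw [hne c hcb]
    simp only [Function.update_self, Meets]
    rcases ha with ha | ha <;> rcases hb with hb | hb <;> simp only [ha, hb] <;> grind

theorem coe_finRotate_inv {m : ℕ} (i : Fin m) :
    ((finRotate m)⁻¹ i).val = if i.val = 0 then m - 1 else i.val - 1 := by
  obtain ⟨j, rfl⟩ := (finRotate m).surjective i
  cases m with
  | zero => exact j.elim0
  | succ m =>
    rw [Equiv.Perm.inv_def, Equiv.symm_apply_apply]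
    rcases eq_or_ne j (Fin.last m) with rfl | hj
    · simp
    · rw [coe_finRotate_of_ne_last hj]
      simp

theorem coe_rotDownBelow {n i : ℕ} (h : i ≤ n) (j : Fin n) :
    (rotDownBelow n i h j).val =
      if j.val < i then (if j.val = 0 then i - 1 else j.val - 1) else j.val := by
  unfold rotDownBelow
  split_ifs with h1 h2
  · rw [Equiv.Perm.extendDomain_apply_subtype _ (blockEquiv n i h) h1]
    exact (coe_finRotate_inv (⟨j.val, h1⟩ : Fin i)).trans (if_pos h2)
  · rw [Equiv.Perm.extendDomain_apply_subtype _ (blockEquiv n i h) h1]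
    exact (coe_finRotate_inv (⟨j.val, h1⟩ : Fin i)).trans (if_neg h2)
  · rw [Equiv.Perm.extendDomain_apply_not_subtype _ (blockEquiv n i h) h1]

theorem coe_rotDownFrom {n a : ℕ} (h : a ≤ n) (j : Fin n) :
    (rotDownFrom n a h j).val =
      if j.val < a then j.val else (if j.val = a then n - 1 else j.val - 1) := by
  have hj := j.isLt
  unfold rotDownFrom
  split_ifs with h1 h2
  · rw [Equiv.Perm.extendDomain_apply_not_subtype _ (tailEquiv n a h) (by omega)]
  · rw [Equiv.Perm.extendDomain_apply_subtype _ (tailEquiv n a h) (by omega : a ≤ j.val)]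
    change a + ((finRotate (n - a))⁻¹ ⟨j.val - a, by omega⟩).val = n - 1
    rw [coe_finRotate_inv, if_pos (by simp [h2])]
    omega
  · rw [Equiv.Perm.extendDomain_apply_subtype _ (tailEquiv n a h) (by omega : a ≤ j.val)]
    change a + ((finRotate (n - a))⁻¹ ⟨j.val - a, by omega⟩).val = j.val - 1
    rw [coe_finRotate_inv, if_neg (by simp only; omega)]
    simp only
    omega

theorem exists_represents_one (n : ℕ) :
    ∃ e : Fin n → ℕ × ℕ, Represents e (1 : Equiv.Perm (Fin n)) := by
  refine ⟨fun i => (0, i.val + 1), fun g => ?_, fun i j _ => by simp [Meets]⟩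
  exact ⟨fun k => if h : 0 < k ∧ k - 1 < n then g ⟨k - 1, h.2⟩ else false, fun i => by simp⟩

/-- The letter of value `0` precedes the last letter, so their edges meet. -/
theorem Represents.meets_zero_last {n : ℕ} {e : Fin n → ℕ × ℕ} {σ : Equiv.Perm (Fin n)}
    (h : Represents e σ) {a b : Fin n} (ha : (σ a).val = 0) (hb : b.val = n - 1) (hab : a ≠ b) :
    Meets (e a) (e b) := by
  have h1 : σ a ≠ σ b := fun h => hab (σ.injective h)
  have h2 := a.isLt
  rw [h.2 a b hab]
  simp only [Fin.lt_def]
  simp only [ne_eq, Fin.ext_iff] at h1 hab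
  omega

theorem Represents.exists_rauzyR {n : ℕ} {e : Fin n → ℕ × ℕ} {σ : Equiv.Perm (Fin n)}
    (he : Represents e σ) : ∃ e', Represents e' (rauzyR σ) := by
  unfold rauzyR
  split_ifs with hn
  swap
  · exact ⟨e, he⟩
  obtain ⟨a, ha⟩ := σ.surjective ⟨0, hn⟩
  have hinv : σ⁻¹ ⟨0, hn⟩ = a := by rw [← ha, Equiv.Perm.inv_def, Equiv.symm_apply_apply]
  have hδ := fun h => coe_rotDownFrom (n := n) (a := a.val + 1) h
  simp only [hinv]
  specialize hδ a.isLt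
  generalize rotDownFrom n (a.val + 1) _ = δ at hδ ⊢
  obtain ⟨b, hb⟩ : ∃ b : Fin n, b.val = n - 1 := ⟨⟨n - 1, by omega⟩, rfl⟩
  have hσ : ∀ c, c ≠ a → (σ a).val < (σ c).val := by
    intro c hc
    have h1 : σ c ≠ σ a := fun h => hc (σ.injective h)
    simp only [ne_eq, Fin.ext_iff, ha] at h1 ⊢
    omega
  by_cases hab : a = b
  · refine ⟨e, he.1, fun i j hij => ?_⟩
    have hδ1 : ∀ i, δ i = i := by
      intro i
      have h1 := hδ i
      have h2 := i.isLt
      rw [if_pos (by rw [hab, hb]; omega)] at h1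
      exact Fin.ext h1
    simpa [hδ1] using he.2 i j hij
  obtain ⟨e', he', hne, hm, hx⟩ :=
    he.1.exists_slide hab (he.meets_zero_last (by rw [ha]) hb hab)
  refine ⟨e' ∘ δ, he'.comp_equiv δ, ?_⟩
  have hlt : ∀ c, c ≠ b → c < b := by
    intro c hc
    have := c.isLt
    simp only [ne_eq, Fin.ext_iff, Fin.lt_def] at hc ⊢
    omega
  have inserted : ∀ i j, i ≠ j → δ j = b →
      (Meets (e' (δ i)) (e' (δ j)) ↔ (i < j ↔ σ (δ i) < σ (δ j))) := by
    intro i j hij hj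
    have hib : δ i ≠ b := fun h => hij (δ.injective (h.trans hj.symm))
    have hdi := hδ i
    have hdj := hδ j
    have hij' : i.val ≠ j.val := fun h => hij (Fin.ext h)
    have hji : j.val = a.val + 1 := by
      have := j.isLt
      rw [hj, hb] at hdj
      have : a.val ≠ b.val := fun h => hab (Fin.ext h)
      split_ifs at hdj <;> omega
    rw [hj]
    by_cases hia : δ i = a
    · rw [hia]
      have h1 := hσ b (Ne.symm hab)
      have h2 : i < j := by
        rw [Fin.lt_def]
        rw [hia] at hdi
        split_ifs at hdi <;> omega
      simp only [hm, h2, true_iff, true_iff]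
      exact h1
    · have h1 := hσ _ hia
      rw [hx _ hia hib, he.2 _ _ hia, he.2 _ _ hib]
      have h2 : δ i < b := hlt _ hib
      have h3 : ¬ σ (δ i) < σ a := by rw [Fin.lt_def]; omega
      have h4 : δ i < a ↔ i < j := by
        simp only [Fin.lt_def]
        have h5 : (δ i).val ≠ a.val := fun h => hia (Fin.ext h)
        split_ifs at hdi <;> omega
      simp only [h2, h3, h4, true_iff, iff_false]
      tauto
  intro i j hij
  have hδij : δ i ≠ δ j := fun h => hij (δ.injective h)
  simp only [Function.comp_apply, Equiv.Perm.mul_apply]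
  by_cases hj : δ j = b
  · exact inserted i j hij hj
  by_cases hi : δ i = b
  · have h1 := inserted j i hij.symm hi
    have h2 : σ (δ i) ≠ σ (δ j) := fun h => hδij (σ.injective h)
    rw [show Meets (e' (δ i)) (e' (δ j)) ↔ Meets (e' (δ j)) (e' (δ i)) from
      ⟨Meets.symm, Meets.symm⟩, h1]
    simp only [Fin.lt_def, ne_eq, Fin.ext_iff] at *
    omega
  · rw [hne _ hi, hne _ hj, he.2 _ _ hδij]
    have h1 : δ i < δ j ↔ i < j := by
      have hdi := hδ i
      have hdj := hδ j
      have h2 := i.isLt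
      have h3 := j.isLt
      simp only [Fin.lt_def, ne_eq, Fin.ext_iff, hb] at *
      split_ifs at hdi hdj <;> omega
    rw [h1]

theorem Represents.exists_rauzyL {n : ℕ} {e : Fin n → ℕ × ℕ} {σ : Equiv.Perm (Fin n)}
    (he : Represents e σ) : ∃ e', Represents e' (rauzyL σ) := by
  unfold rauzyL
  split_ifs with hn
  swap
  · exact ⟨e, he⟩
  obtain ⟨b, hb⟩ : ∃ b : Fin n, b = ⟨n - 1, by omega⟩ := ⟨_, rfl⟩
  simp only [← hb]
  replace hb : b.val = n - 1 := by rw [hb]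
  obtain ⟨a, ha⟩ := σ.surjective ⟨0, hn⟩
  replace ha : (σ a).val = 0 := by rw [ha]
  have hγ := coe_rotDownBelow (σ b).isLt.le
  generalize rotDownBelow n (σ b).val _ = γ at hγ ⊢
  have hσ : ∀ c, c ≠ a → 0 < (σ c).val := by
    intro c hc
    have h1 : σ c ≠ σ a := fun h => hc (σ.injective h)
    simp only [ne_eq, Fin.ext_iff] at h1
    omega
  by_cases hab : a = b
  · refine ⟨e, he.1, fun i j hij => ?_⟩
    have hγ1 : ∀ i, γ i = i := by
      intro i
      have h1 := hγ i
      rw [if_neg (by rw [← hab, ha]; omega)] at h1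
      exact Fin.ext h1
    simpa [hγ1] using he.2 i j hij
  obtain ⟨e', he', hne, hm, hx⟩ :=
    he.1.exists_slide (Ne.symm hab) (he.meets_zero_last ha hb hab).symm
  refine ⟨e', he', ?_⟩
  have hlt : ∀ c, c ≠ b → c < b := by
    intro c hc
    have := c.isLt
    simp only [ne_eq, Fin.ext_iff, Fin.lt_def] at hc ⊢
    omega
  have hp := hσ b (Ne.symm hab)
  have hγa : (γ (σ a)).val = (σ b).val - 1 := by
    rw [hγ, ha, if_pos hp, if_pos rfl]
  have inserted : ∀ c, c ≠ a →
      (Meets (e' c) (e' a) ↔ (c < a ↔ γ (σ c) < γ (σ a))) := by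
    intro c hca
    by_cases hcb : c = b
    · subst hcb
      have h1 : ¬ c < a := (hlt a hab).asymm
      have h2 : ¬ γ (σ c) < γ (σ a) := by
        rw [Fin.lt_def, hγa, hγ]
        simp
      simp only [hm, h1, h2]
    · rw [hx _ hcb hca, he.2 _ _ hcb, he.2 _ _ hca]
      have h1 : ¬ σ c < σ a := by rw [Fin.lt_def]; omega
      have h2 : σ c < σ b ↔ γ (σ c) < γ (σ a) := by
        have h3 := hσ c hca
        have h4 : σ c ≠ σ b := fun h => hcb (σ.injective h)
        have h5 := hγ (σ c)
        simp only [Fin.lt_def, hγa, ne_eq, Fin.ext_iff] at *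
        split_ifs at h5 <;> omega
      simp only [h1, h2, hlt c hcb, true_iff, iff_false]
      tauto
  intro i j hij
  simp only [Equiv.Perm.mul_apply]
  by_cases hj : j = a
  · subst hj
    exact inserted i hij
  by_cases hi : i = a
  · subst hi
    have h1 := inserted j hij.symm
    have h2 : γ (σ i) ≠ γ (σ j) := fun h => hij (σ.injective (γ.injective h))
    rw [show Meets (e' i) (e' j) ↔ Meets (e' j) (e' i) from ⟨Meets.symm, Meets.symm⟩, h1]
    simp only [Fin.lt_def, ne_eq, Fin.ext_iff] at *
    omega
  · rw [hne _ hi, hne _ hj, he.2 _ _ hij]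
    have h1 : γ (σ i) < γ (σ j) ↔ σ i < σ j := by
      have hdi := hγ (σ i)
      have hdj := hγ (σ j)
      have h2 := hσ i hi
      have h3 := hσ j hj
      simp only [Fin.lt_def]
      split_ifs at hdi hdj <;> omega
    rw [h1]

theorem exists_represents_of_rauzyReach {n : ℕ} {σ τ : Equiv.Perm (Fin n)}
    (h : rauzyReach σ τ) (hσ : ∃ e, Represents e σ) : ∃ e, Represents e τ := by
  induction h with
  | refl => exact hσ
  | tail _ hs ih =>
    obtain ⟨e, he⟩ := ih
    rcases hs with rfl | rfl
    · exact he.exists_rauzyL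
    · exact he.exists_rauzyR

theorem rauzyL_injective {n : ℕ} : Function.Injective (rauzyL (n := n)) := by
  intro σ τ h
  by_cases hn : 0 < n
  · have hlast : ∀ ρ : Equiv.Perm (Fin n),
        rauzyL ρ ⟨n - 1, by omega⟩ = ρ ⟨n - 1, by omega⟩ := by
      intro ρ
      apply Fin.ext
      simp [rauzyL, hn, coe_rotDownBelow]
    have hp : σ ⟨n - 1, by omega⟩ = τ ⟨n - 1, by omega⟩ := by
      rw [← hlast σ, ← hlast τ, h]
    simpa only [rauzyL, dif_pos hn, hp, mul_right_inj] using h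
  · simpa only [rauzyL, dif_neg hn] using h

theorem rauzyR_injective {n : ℕ} : Function.Injective (rauzyR (n := n)) := by
  intro σ τ h
  by_cases hn : 0 < n
  · have hzero : ∀ ρ : Equiv.Perm (Fin n), (rauzyR ρ)⁻¹ ⟨0, hn⟩ = ρ⁻¹ ⟨0, hn⟩ := by
      intro ρ
      rw [Equiv.Perm.inv_eq_iff_eq]
      simp only [rauzyR, dif_pos hn, Equiv.Perm.mul_apply]
      rw [← Equiv.Perm.inv_eq_iff_eq]
      apply Fin.ext
      rw [coe_rotDownFrom, if_pos (Nat.lt_succ_self _)]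
    have hp : σ⁻¹ ⟨0, hn⟩ = τ⁻¹ ⟨0, hn⟩ := by rw [← hzero σ, ← hzero τ, h]
    simpa only [rauzyR, dif_pos hn, hp, mul_left_inj] using h
  · simpa only [rauzyR, dif_neg hn] using h

/-- An injective self-map of a finite type can be undone by iterating it. -/
theorem reflTransGen_apply_self {α : Type*} [Finite α] {r : α → α → Prop} {f : α → α}
    (hf : Function.Injective f) (hr : ∀ x, r x (f x)) (x : α) :
    Relation.ReflTransGen r (f x) x := by
  have iter : ∀ k y, Relation.ReflTransGen r y (f^[k] y) := by
    intro k y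
    induction k with
    | zero => exact .refl
    | succ k ih =>
      rw [Function.iterate_succ_apply']
      exact ih.tail (hr _)
  obtain ⟨k, hk, hx⟩ := hf.mem_periodicPts x
  have h := iter (k - 1) (f x)
  rwa [← Function.iterate_succ_apply, Nat.succ_eq_add_one, Nat.sub_add_cancel hk, hx] at h

theorem rauzyReach.symm {n : ℕ} {σ τ : Equiv.Perm (Fin n)} (h : rauzyReach σ τ) :
    rauzyReach τ σ := by
  induction h with
  | refl => exact .refl
  | tail _ hs ih =>
    refine Relation.ReflTransGen.trans ?_ ih
    rcases hs with rfl | rfl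
    · exact reflTransGen_apply_self rauzyL_injective (fun _ => Or.inl rfl) _
    · exact reflTransGen_apply_self rauzyR_injective (fun _ => Or.inr rfl) _

/-- In an independent family, if two distinct edges meet every edge then all edges have a
common vertex. -/
theorem IndepEdges.meets_of_forall_meets {ι : Type*} {e : ι → ℕ × ℕ} (he : IndepEdges e)
    {a b : ι} (hab : a ≠ b) (ha : ∀ c, c ≠ a → Meets (e c) (e a))
    (hb : ∀ c, c ≠ b → Meets (e c) (e b)) (i j : ι) : Meets (e i) (e j) := by
  obtain ⟨u, v, w, huv, huw, hvw, hea, heb, hc⟩ :=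
    he.exists_common_vertex hab (hb a hab)
  have common : ∀ c, (e c).1 = u ∨ (e c).2 = u := by
    intro c
    by_cases hca : c = a
    · subst hca
      rcases hea with h | h <;> simp [h]
    by_cases hcb : c = b
    · subst hcb
      rcases heb with h | h <;> simp [h]
    obtain ⟨h, h1, h2, h3⟩ := hc c hca hcb
    have h4 := ha c hca
    have h5 := hb c hcb
    unfold Meets at h4 h5
    rcases hea with hea | hea <;> rcases heb with heb | heb <;>
      simp only [hea, heb] at h4 h5 <;> grind
  have hi := common i
  have hj := common j
  unfold Meets
  grind

theorem Represents.eq_one {n : ℕ} {e : Fin n → ℕ × ℕ} {σ : Equiv.Perm (Fin n)}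
    (he : Represents e σ) {a b : Fin n} (ha : a.val = n - 2) (hb : b.val = n - 1) (hab : a ≠ b)
    (hσa : σ a = a) (hσb : σ b = b) : σ = 1 := by
  have hmeets := he.1.meets_of_forall_meets hab
    (fun c hc => by
      have h1 : σ c ≠ a := fun h => hc (σ.injective (h.trans hσa.symm))
      have h2 : c ≠ b → σ c ≠ b := fun hcb h => hcb (σ.injective (h.trans hσb.symm))
      have h3 : c = b → σ c = b := fun h => by rw [h, hσb]
      rw [he.2 c a hc, hσa]
      have h4 := c.isLt
      have h5 := (σ c).isLt
      simp only [Fin.lt_def, Fin.ext_iff, ne_eq] at *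
      omega)
    (fun c hc => by
      have h1 : σ c ≠ b := fun h => hc (σ.injective (h.trans hσb.symm))
      rw [he.2 c b hc, hσb]
      have h4 := c.isLt
      have h5 := (σ c).isLt
      simp only [Fin.lt_def, Fin.ext_iff, ne_eq] at *
      omega)
  have hmono : StrictMono σ := fun i j hij =>
    ((he.2 i j hij.ne).1 (hmeets i j)).1 hij
  have h : (hmono.orderIsoOfSurjective σ σ.surjective) = OrderIso.refl (Fin n) :=
    Subsingleton.elim _ _
  ext i
  have := congrArg (fun f : Fin n ≃o Fin n => (f i).val) h
  simpa using this

/-- The identity is the unique permutation in its Rauzy class fixing the last two points. -/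
theorem identity_unique_with_two_fixed_points {n : ℕ} (hn : 2 ≤ n) :
    ∀ σ : Equiv.Perm (Fin n),
      (rauzyConnected (1 : Equiv.Perm (Fin n)) σ ∧
        σ ⟨n - 2, by omega⟩ = ⟨n - 2, by omega⟩ ∧
        σ ⟨n - 1, by omega⟩ = ⟨n - 1, by omega⟩) ↔ σ = 1 := by
  intro σ
  constructor
  · rintro ⟨hc, ha, hb⟩
    have hreach : rauzyReach 1 σ := hc.elim id rauzyReach.symm
    obtain ⟨e, he⟩ := exists_represents_of_rauzyReach hreach (exists_represents_one n)
    exact he.eq_one rfl rfl (by simp only [ne_eq, Fin.mk.injEq]; omega) ha hb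
  · rintro rfl
    exact ⟨Or.inl .refl, rfl, rfl⟩

end Rauzy
end
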